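/- arXiv:1104.0410 — 2 statements merged into one kernel-verified Lean document; each statement's English description precedes it below -/
import Mathlib

section
/- Let K be a number field, let S be a finite set of nonzero prime ideals of the ring of integers O_K, and let m > 2 be an integer. Then there is a finite set W contained in the ring O_{K,S} of S-integers of K with the following property: for every γ ∈ SL₂(O_{K,S}) with trace(γ) ∉ W, there exists a nonzero prime ideal 𝔭 of O_K with 𝔭 ∉ S such that the image of γ under the entrywise reduction homomorphism SL₂(O_{K,S}) → SL₂(k_𝔭) composed with the projection SL₂(k_𝔭) → PSL₂(k_𝔭) has order exactly m, where k_𝔭 denotes the residue field at 𝔭. In particular, m is a finitistic order for γ as an element of the group SL₂(O_{K,S}). -/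
open scoped MatrixGroups
open NumberField IsDedekindDomain

/-- `m` is a finitistic order for `γ` in `Γ` if there are a finite group `G` and a
homomorphism `h : Γ →* G` such that `h γ` has order exactly `m`. -/
def FinitisticOrder {Γ : Type*} [Group Γ] (m : ℕ) (γ : Γ) : Prop :=
  ∃ (G : Type) (_ : Group G) (_ : Finite G) (h : Γ →* G), orderOf (h γ) = m

variable {K : Type} [Field K] [NumberField K]

/-- The residue field `k_v` of `K` at a nonzero prime (height-one) ideal `v` of `𝓞 K`:
the residue field of the corresponding valuation subring of `K`. -/
noncomputable abbrev residueFieldAt (v : HeightOneSpectrum (𝓞 K)) : Type :=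
  IsLocalRing.ResidueField (HeightOneSpectrum.valuation (K := K) v).valuationSubring

/-- Entrywise reduction modulo a prime `v ∉ S`, as a ring homomorphism from the ring of
`S`-integers of `K` to the residue field at `v`. -/
noncomputable def sIntegerReduction (S : Set (HeightOneSpectrum (𝓞 K)))
    (v : HeightOneSpectrum (𝓞 K)) (hv : v ∉ S) :
    (S.integer K) →+* residueFieldAt v :=
  (IsLocalRing.residue _).comp
    { toFun := fun x => ⟨(x : K), (Valuation.mem_valuationSubring_iff _ _).2
        (Set.integer_valuation_le_one S K x hv)⟩
      map_one' := rfl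
      map_mul' := fun _ _ => rfl
      map_zero' := rfl
      map_add' := fun _ _ => rfl }

section Part1
namespace SUnitAux
open Polynomial

theorem beta_nat (j k : ℕ) : ∫ u in (0:ℝ)..1, u ^ j * (1 - u) ^ k =
    (j.factorial * k.factorial : ℝ) / (j + k + 1).factorial := by
  induction k generalizing j with
  | zero =>
    simp [integral_pow, Nat.factorial_succ]
    field_simp
  | succ k ih =>
    have h : ∀ u : ℝ, u ^ j * (1 - u) ^ (k+1) = u ^ j * (1 - u) ^ k - u ^ (j+1) * (1 - u) ^ k := by
      intro u; ring
    simp_rw [h]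
    rw [intervalIntegral.integral_sub, ih, ih]
    · have e1 : j + 1 + k + 1 = (j + k + 1) + 1 := by ring
      have e2 : j + (k + 1) + 1 = (j + k + 1) + 1 := by ring
      rw [e1, e2, Nat.factorial_succ (j+k+1), Nat.factorial_succ j, Nat.factorial_succ k]
      push_cast
      field_simp
      ring
    · exact Continuous.intervalIntegrable (by fun_prop) _ _
    · exact Continuous.intervalIntegrable (by fun_prop) _ _

/-- coefficients of first kind -/
def cA (a b c k : ℕ) : ℕ := (a + k).choose k * (a + b + c + 1).choose (b - k)
/-- coefficients of second kind -/
def cC (a b c k : ℕ) : ℕ := (a + (c - k)).choose (c - k) * (a + b + c + 1).choose k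

noncomputable def pA (a b c : ℕ) : ℤ[X] :=
  ∑ k ∈ Finset.range (b + 1), C (cA a b c k : ℤ) * (-X) ^ k
noncomputable def pC (a b c : ℕ) : ℤ[X] :=
  ∑ k ∈ Finset.range (c + 1), C (cC a b c k : ℤ) * (-X) ^ k

theorem int_pA (a b c : ℕ) (x : ℝ) :
    ((a + b + c + 1).factorial : ℝ) / (a.factorial * b.factorial * c.factorial) *
      ∫ u in (0:ℝ)..1, u ^ a * (1 - x * u) ^ b * (1 - u) ^ c = aeval x (pA a b c) := by
  have h : ∀ u : ℝ, u ^ a * (1 - x * u) ^ b * (1 - u) ^ c =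
      ∑ k ∈ Finset.range (b + 1), ((b.choose k : ℝ) * (-x) ^ k) * (u ^ (a + k) * (1 - u) ^ c) := by
    intro u
    have : (1 - x * u) ^ b = ((-x*u) + 1) ^ b := by ring
    rw [this, add_pow, Finset.mul_sum, Finset.sum_mul]
    refine Finset.sum_congr rfl fun k _ => ?_
    rw [mul_pow, pow_add]; ring
  simp_rw [h]
  rw [intervalIntegral.integral_finsetSum]
  · simp_rw [intervalIntegral.integral_const_mul, beta_nat]
    rw [Finset.mul_sum, pA, map_sum]
    refine Finset.sum_congr rfl fun k hk => ?_
    have hk : k ≤ b := by simpa [Nat.lt_succ_iff] using hk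
    obtain ⟨l, rfl⟩ := Nat.exists_eq_add_of_le hk
    simp only [map_mul, map_pow, map_neg, aeval_X, eq_intCast, cA, map_natCast, Nat.cast_mul,
      Int.cast_natCast, Int.cast_mul]
    rw [Nat.cast_add_choose ℝ (a := k) (b := l), Nat.add_sub_cancel_left,
      show a + k = k + a by ring, Nat.cast_add_choose ℝ (a := k) (b := a),
      show a + (k + l) + c + 1 = l + (k + a + c + 1) by ring,
      Nat.cast_add_choose ℝ (a := l) (b := k + a + c + 1)]
    field_simp
  · intro i _
    exact Continuous.intervalIntegrable (by fun_prop) _ _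

theorem int_pC (a b c : ℕ) (x : ℝ) :
    ((a + b + c + 1).factorial : ℝ) / (a.factorial * b.factorial * c.factorial) *
      ∫ u in (0:ℝ)..1, u ^ a * (1 - u) ^ b * (u - x) ^ c = aeval x (pC a b c) := by
  have h : ∀ u : ℝ, u ^ a * (1 - u) ^ b * (u - x) ^ c =
      ∑ k ∈ Finset.range (c + 1), ((c.choose k : ℝ) * (-x) ^ k) *
        (u ^ (a + (c - k)) * (1 - u) ^ b) := by
    intro u
    have : (u - x) ^ c = (-x + u) ^ c := by ring
    rw [this, add_pow, Finset.mul_sum]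
    refine Finset.sum_congr rfl fun k _ => ?_
    rw [pow_add]; ring
  simp_rw [h]
  rw [intervalIntegral.integral_finsetSum]
  · simp_rw [intervalIntegral.integral_const_mul, beta_nat]
    rw [Finset.mul_sum, pC, map_sum]
    refine Finset.sum_congr rfl fun k hk => ?_
    have hk : k ≤ c := by simpa [Nat.lt_succ_iff] using hk
    obtain ⟨l, rfl⟩ := Nat.exists_eq_add_of_le hk
    simp only [map_mul, map_pow, map_neg, aeval_X, eq_intCast, cC, map_natCast, Nat.cast_mul,
      Int.cast_natCast, Int.cast_mul]
    rw [Nat.cast_add_choose ℝ (a := k) (b := l), Nat.add_sub_cancel_left,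
      show a + l = l + a by ring, Nat.cast_add_choose ℝ (a := l) (b := a),
      show a + b + (k + l) + 1 = k + (l + a + b + 1) by ring,
      Nat.cast_add_choose ℝ (a := k) (b := l + a + b + 1)]
    field_simp
  · intro i _
    exact Continuous.intervalIntegrable (by fun_prop) _ _

theorem real_identity (a b c : ℕ) (x : ℝ) :
    (-1) ^ c * x ^ (a + c + 1) * aeval x (pA a b c) +
      (1 - x) ^ (b + c + 1) * aeval (1 - x) (pA b a c) = aeval x (pC a b c) := by
  rw [← int_pA, ← int_pA, ← int_pC]
  have key : ∀ (a b : ℕ) (x : ℝ), x ^ (a + c + 1) * ∫ u in (0:ℝ)..1, u ^ a * (1 - x * u) ^ b * (1 - u) ^ c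
      = ∫ t in (0:ℝ)..x, t ^ a * (1 - t) ^ b * (x - t) ^ c := by
    intro a b x
    have := intervalIntegral.smul_integral_comp_mul_left (a := 0) (b := 1)
      (fun t : ℝ => t ^ a * (1 - t) ^ b * (x - t) ^ c) x
    simp only [mul_zero, mul_one] at this
    rw [← this, smul_eq_mul, pow_succ', mul_assoc, ← intervalIntegral.integral_const_mul]
    congr 2
    ext u
    rw [show x - x * u = x * (1 - u) by ring, mul_pow, mul_pow, pow_add]
    ring
  have e1 := key a b x
  have e2 := key b a (1 - x)
  have e3 := intervalIntegral.integral_comp_sub_left (a := 0) (b := 1 - x)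
      (fun t : ℝ => t ^ a * (1 - t) ^ b * (t - x) ^ c) 1
  have e4 := intervalIntegral.integral_add_adjacent_intervals (μ := MeasureTheory.volume)
    (a := 0) (b := x) (c := 1) (f := (fun t : ℝ => t ^ a * (1 - t) ^ b * (t - x) ^ c))
    (Continuous.intervalIntegrable (by fun_prop) _ _)
    (Continuous.intervalIntegrable (by fun_prop) _ _)
  have e5 : ∫ t in (0:ℝ)..x, t ^ a * (1 - t) ^ b * (t - x) ^ c =
      (-1) ^ c * ∫ t in (0:ℝ)..x, t ^ a * (1 - t) ^ b * (x - t) ^ c := by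
    rw [← intervalIntegral.integral_const_mul]
    congr 1; ext t
    rw [show t - x = (-1) * (x - t) by ring, mul_pow]; ring
  have e6 : ∫ t in (0:ℝ)..(1-x), t ^ b * (1 - t) ^ a * (1 - x - t) ^ c =
      ∫ t in (x:ℝ)..1, t ^ a * (1 - t) ^ b * (t - x) ^ c := by
    rw [show (1:ℝ) - (1 - x) = x by ring, show (1:ℝ) - 0 = 1 by ring] at e3
    rw [← e3]
    congr 1; ext t
    ring
  rw [← e4, e5, ← e6, ← e1, ← e2, show b + a + c + 1 = a + b + c + 1 by ring]
  ring

theorem poly_identity (a b c : ℕ) :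
    (-1) ^ c * X ^ (a + c + 1) * pA a b c +
      (1 - X) ^ (b + c + 1) * (pA b a c).comp (1 - X) = pC a b c := by
  have hinj : Function.Injective (Int.castRingHom ℝ) := Int.cast_injective
  apply Polynomial.map_injective _ hinj
  apply Polynomial.funext
  intro x
  have := real_identity a b c x
  simp only [aeval_def, algebraMap_int_eq] at this
  simp only [eval_map, eval₂_add, eval₂_mul, eval₂_pow, eval₂_neg, eval₂_one, eval₂_X, eval₂_comp,
    eval₂_sub]
  exact this

end SUnitAux
end Part1

section Part2
namespace SUnitAux
open Polynomial

/-- degree and coefficient bounds -/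
def Nice (N : ℕ) (P : ℤ[X]) : Prop := P.natDegree ≤ N ∧ ∀ k, |P.coeff k| ≤ 64 ^ N

theorem coeff_aux (f : ℕ → ℕ) (d j : ℕ) :
    (∑ k ∈ Finset.range (d + 1), C (f k : ℤ) * (-X) ^ k : ℤ[X]).coeff j =
      if j ≤ d then (-1) ^ j * (f j : ℤ) else 0 := by
  have h : ∀ k : ℕ, C (f k : ℤ) * (-X) ^ k = C ((-1) ^ k * (f k : ℤ)) * X ^ k := by
    intro k
    rw [neg_pow]
    simp only [map_mul, map_pow, map_neg, map_one]
    ring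
  simp_rw [h, finsetSum_coeff, coeff_C_mul, coeff_X_pow]
  simp [Nat.lt_succ_iff]

theorem nice_aux (f : ℕ → ℕ) (d N : ℕ) (hd : d ≤ N) (hf : ∀ k ≤ d, f k ≤ 64 ^ N) :
    Nice N (∑ k ∈ Finset.range (d + 1), C (f k : ℤ) * (-X) ^ k : ℤ[X]) := by
  constructor
  · rw [natDegree_le_iff_coeff_eq_zero]
    intro j hj
    rw [coeff_aux, if_neg (by omega)]
  · intro k
    rw [coeff_aux]
    split_ifs with h
    · rw [abs_mul, abs_pow, abs_neg, abs_one, one_pow, one_mul, Nat.abs_cast]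
      exact_mod_cast hf k h
    · simp

theorem choose_aux {n k e : ℕ} (h : n ≤ e) : n.choose k ≤ 2 ^ e :=
  (Nat.choose_le_two_pow n k).trans (Nat.pow_le_pow_right (by norm_num) h)

theorem nice_pA {a b c N : ℕ} (hN : 1 ≤ N) (ha : a ≤ N) (hb : b ≤ N) (hc : c ≤ N) :
    Nice N (pA a b c) := by
  apply nice_aux _ _ _ hb
  intro k hk
  calc cA a b c k ≤ 2 ^ (2 * N) * 2 ^ (4 * N) :=
        Nat.mul_le_mul (choose_aux (by omega)) (choose_aux (by omega))
    _ = 64 ^ N := by rw [← pow_add, show 2 * N + 4 * N = 6 * N by ring, pow_mul]; norm_num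

theorem nice_pC {a b c N : ℕ} (hN : 1 ≤ N) (ha : a ≤ N) (hb : b ≤ N) (hc : c ≤ N) :
    Nice N (pC a b c) := by
  apply nice_aux _ _ _ hc
  intro k hk
  calc cC a b c k ≤ 2 ^ (2 * N) * 2 ^ (4 * N) :=
        Nat.mul_le_mul (choose_aux (by omega)) (choose_aux (by omega))
    _ = 64 ^ N := by rw [← pow_add, show 2 * N + 4 * N = 6 * N by ring, pow_mul]; norm_num

theorem Nice.sign {N : ℕ} {P : ℤ[X]} (h : Nice N P) (c : ℕ) : Nice N ((-1) ^ c * P) := by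
  rcases neg_one_pow_eq_or ℤ[X] c with h' | h' <;> rw [h']
  · simpa using h
  · refine ⟨by simpa using h.1, fun k => by simpa using h.2 k⟩

theorem Nice.bound {N : ℕ} {P : ℤ[X]} (h : Nice N P) {K : Type*} [Field K]
    (v : AbsoluteValue K ℝ) (x : K) : v (aeval x P) ≤ 128 ^ N * (max 1 (v x)) ^ N := by
  rw [aeval_eq_sum_range' (n := N + 1) (by have := h.1; omega)]
  have hz : ∀ z : ℤ, v (z : K) ≤ |(z : ℝ)| := by
    have hn : ∀ n : ℕ, v (n : K) ≤ n := by
      intro n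
      induction n with
      | zero => simp
      | succ n ih =>
        push_cast
        exact (v.add_le _ _).trans (by simpa using ih)
    intro z
    rcases Int.eq_nat_or_neg z with ⟨n, rfl | rfl⟩
    · simpa using hn n
    · simpa using hn n
  have h1 : (1:ℝ) ≤ max 1 (v x) := le_max_left _ _
  calc v (∑ i ∈ Finset.range (N + 1), P.coeff i • x ^ i)
      ≤ ∑ i ∈ Finset.range (N + 1), v (P.coeff i • x ^ i) := v.sum_le _ _
    _ ≤ ∑ i ∈ Finset.range (N + 1), 64 ^ N * (max 1 (v x)) ^ N := by
        refine Finset.sum_le_sum fun i hi => ?_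
        rw [zsmul_eq_mul, map_mul, map_pow]
        have hi : i ≤ N := by simpa [Nat.lt_succ_iff] using hi
        gcongr
        · refine (hz _).trans ?_
          exact_mod_cast h.2 i
        · calc v x ^ i ≤ (max 1 (v x)) ^ i := by gcongr; exact le_max_right _ _
            _ ≤ _ := pow_le_pow_right₀ h1 hi
    _ = (N + 1) * (64 ^ N * (max 1 (v x)) ^ N) := by simp
    _ ≤ 2 ^ N * (64 ^ N * (max 1 (v x)) ^ N) := by
        gcongr
        exact_mod_cast Nat.lt_two_pow_self (n := N)
    _ = _ := by rw [← mul_assoc, ← mul_pow]; norm_num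

theorem indep {K : Type*} [Field K] (n : ℕ) (A₁ B₁ C₁ A₂ B₂ C₂ : K[X])
    (hA₁ : A₁.natDegree ≤ n) (hC₁ : C₁.natDegree ≤ n)
    (hA₂ : A₂.natDegree ≤ n) (hC₂ : C₂.natDegree ≤ n)
    (h₁ : X ^ (2 * n) * A₁ + (1 - X) ^ (2 * n) * B₁ = C₁)
    (h₂ : X ^ (2 * n) * A₂ + (1 - X) ^ (2 * n) * B₂ = C₂)
    (h0 : (C₁ * A₂ - C₂ * A₁).eval 0 ≠ 0) (x : K) (hx : x ≠ 1) :
    (C₁ * A₂ - C₂ * A₁).eval x ≠ 0 := by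
  set E := C₁ * A₂ - C₂ * A₁ with hE
  have hdvd : (1 - X : K[X]) ^ (2 * n) ∣ E := by
    have hcop : IsCoprime ((1 - X : K[X]) ^ (2 * n)) (X ^ (2 * n)) := by
      apply IsCoprime.pow
      exact ⟨1, 1, by ring⟩
    apply hcop.dvd_of_dvd_mul_left
    refine ⟨C₂ * B₁ - C₁ * B₂, ?_⟩
    rw [hE]
    linear_combination C₁ * h₂ - C₂ * h₁
  obtain ⟨Q, hQ⟩ := hdvd
  have hE0 : E ≠ 0 := by rintro h; rw [h] at h0; simp at h0
  have hdeg : E.natDegree ≤ 2 * n := by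
    refine (natDegree_sub_le _ _).trans (max_le ?_ ?_)
    · exact natDegree_mul_le.trans (by omega)
    · exact natDegree_mul_le.trans (by omega)
  have h1X : (1 - X : K[X]).natDegree = 1 := by
    have : (1 - X : K[X]) = -(X - C 1) := by simp
    rw [this, natDegree_neg, natDegree_X_sub_C]
  have hQ0 : Q ≠ 0 := by rintro rfl; simp at hQ; exact hE0 hQ
  have h1X0 : (1 - X : K[X]) ^ (2 * n) ≠ 0 := by
    intro h; rw [h, zero_mul] at hQ; exact hE0 hQ
  have hQd : Q.natDegree = 0 := by
    rw [hQ, natDegree_mul h1X0 hQ0, natDegree_pow, h1X] at hdeg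
    omega
  obtain ⟨q, rfl⟩ := natDegree_eq_zero.mp hQd
  rw [hQ]
  simp only [eval_mul, eval_pow, eval_sub, eval_one, eval_X, eval_C]
  refine mul_ne_zero (pow_ne_zero _ (sub_ne_zero.mpr (Ne.symm hx))) ?_
  rintro rfl
  simp at hQ0

theorem pade {K : Type*} [Field K] [CharZero K] (N : ℕ) (hN : 1 ≤ N) (x ξ : K) (hx : x ≠ 1) :
    ∃ P Q R : ℤ[X], Nice N P ∧ Nice N Q ∧ Nice N R ∧
      x ^ (2 * N) * aeval x P + (1 - x) ^ (2 * N) * aeval (1 - x) Q = aeval x R ∧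
      aeval x P - aeval x R * ξ ≠ 0 := by
  obtain ⟨n, rfl⟩ : ∃ n, N = n + 1 := ⟨N - 1, by omega⟩
  set N := n + 1 with hNn
  set P₁ : ℤ[X] := (-1) ^ N * (X * pA N n N) with hP₁
  set P₂ : ℤ[X] := (-1) ^ n * (pA N N n) with hP₂
  have id₁ := poly_identity N n N
  have id₂ := poly_identity N N n
  have nX : Nice N (X * pA N n N) := by
    have hp : Nice N (pA N n N) := nice_pA hN le_rfl (by omega) le_rfl
    refine ⟨?_, ?_⟩
    · have : (pA N n N).natDegree ≤ n := by
        rw [natDegree_le_iff_coeff_eq_zero]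
        intro j hj
        rw [pA, coeff_aux, if_neg (by omega)]
      refine natDegree_mul_le.trans ?_
      rw [natDegree_X]; omega
    · intro k
      cases k with
      | zero => simp
      | succ k => rw [coeff_X_mul]; exact hp.2 k
  have nP₁ : Nice N P₁ := nX.sign N
  have nP₂ : Nice N P₂ := (nice_pA hN le_rfl le_rfl (by omega)).sign n
  have nR₁ : Nice N (pC N n N) := nice_pC hN le_rfl (by omega) le_rfl
  have nR₂ : Nice N (pC N N n) := nice_pC hN le_rfl le_rfl (by omega)
  have id₁' : X ^ (2 * N) * P₁ + (1 - X) ^ (2 * N) * (pA n N N).comp (1 - X) = pC N n N := by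
    rw [← id₁, hP₁]
    rw [show n + N + 1 = 2 * N by omega, show N + N + 1 = 2 * N + 1 by omega, pow_succ]
    ring
  have id₂' : X ^ (2 * N) * P₂ + (1 - X) ^ (2 * N) * (pA N N n).comp (1 - X) = pC N N n := by
    rw [← id₂, hP₂]
    rw [show N + n + 1 = 2 * N by omega]
    ring
  have hev : (aeval x (pC N n N)) * (aeval x P₂) - (aeval x (pC N N n)) * (aeval x P₁) ≠ 0 := by
    have m := indep (K := K) N (P₁.map (Int.castRingHom K))
      (((pA n N N).comp (1 - X)).map (Int.castRingHom K)) ((pC N n N).map (Int.castRingHom K))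
      (P₂.map (Int.castRingHom K))
      (((pA N N n).comp (1 - X)).map (Int.castRingHom K)) ((pC N N n).map (Int.castRingHom K))
      (natDegree_map_le.trans nP₁.1) (natDegree_map_le.trans nR₁.1)
      (natDegree_map_le.trans nP₂.1) (natDegree_map_le.trans nR₂.1)
      (by rw [← id₁']; simp) (by rw [← id₂']; simp)
      (by
        rw [← coeff_zero_eq_eval_zero]
        simp only [coeff_sub, mul_coeff_zero, coeff_map]
        have z1 : P₁.coeff 0 = 0 := by simp [hP₁, mul_coeff_zero]
        have z2 : P₂.coeff 0 ≠ 0 := by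
          rw [hP₂, mul_coeff_zero, pA, coeff_aux]
          have : ((-1) ^ n : ℤ[X]).coeff 0 = (-1) ^ n := by
            rw [coeff_zero_eq_eval_zero]; simp
          rw [this]
          simp [cA, Nat.choose_eq_zero_iff]
          omega
        have z3 : (pC N n N).coeff 0 ≠ 0 := by
          rw [pC, coeff_aux]
          simp [cC, Nat.choose_eq_zero_iff]
        rw [z1]
        simp [z2, z3]) x hx
    simpa [aeval_def, eval_map] using m
  have ev₁ := congrArg (aeval x) id₁'
  have ev₂ := congrArg (aeval x) id₂'
  simp only [map_add, map_mul, map_pow, map_sub, map_one, aeval_X, aeval_comp] at ev₁ ev₂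
  by_cases h : aeval x P₁ - aeval x (pC N n N) * ξ = 0
  · refine ⟨P₂, pA N N n, pC N N n, nP₂, nice_pA hN le_rfl le_rfl (by omega), nR₂, ev₂, ?_⟩
    intro h'
    apply hev
    linear_combination aeval x (pC N n N) * h' - aeval x (pC N N n) * h
  · exact ⟨P₁, pA n N N, pC N n N, nP₁, nice_pA hN (by omega) le_rfl le_rfl, nR₁, ev₁, h⟩

end SUnitAux
end Part2

section Part3
namespace SUnitAux
open Polynomial

theorem gap {E : Type*} [NormedAddCommGroup E] [NormedSpace ℝ E] [FiniteDimensional ℝ E]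
    (V : Set E) (α C : ℝ) (hα : 0 < α) (hC : 0 ≤ C)
    (h : ∀ v ∈ V, ∀ v' ∈ V, ∀ N : ℕ, 1 ≤ N →
      α * N * ‖v‖ ≤ ‖v' - (2 * N : ℝ) • v‖ + C * N) : ∃ B : ℝ, ∀ v ∈ V, ‖v‖ ≤ B := by
  by_contra! hV
  choose w hwV hw using fun n : ℕ => hV (n + 1)
  have hpos : ∀ n, 0 < ‖w n‖ := fun n => by
    have := hw n
    have : (0:ℝ) ≤ n := Nat.cast_nonneg n
    linarith
  have : ProperSpace E := FiniteDimensional.proper ℝ E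
  obtain ⟨u, -, φ, hφ, hlim⟩ := (isCompact_sphere (0 : E) 1).tendsto_subseq
    (x := fun n => (‖w n‖)⁻¹ • w n) (fun n => by
      simp [norm_smul, (hpos n).ne'])
  have hcau := hlim.cauchySeq
  rw [Metric.cauchySeq_iff] at hcau
  obtain ⟨n0, hn0⟩ := hcau (α / 8) (by positivity)
  obtain ⟨n1, hn1⟩ := exists_nat_ge (4 * C / α)
  set n := max n0 n1 with hn
  set v := w (φ n) with hv
  have hvpos : 0 < ‖v‖ := hpos _
  have hvbig : 4 * C / α ≤ ‖v‖ := by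
    have h1 : (n1 : ℝ) ≤ φ n := by
      exact_mod_cast (le_max_right n0 n1).trans (hφ.id_le n)
    have h2 := hw (φ n)
    linarith
  obtain ⟨n2, hn2⟩ := exists_nat_ge (2 * (8 / α + 2) * ‖v‖)
  set n' := max n0 n2 with hn'
  set v' := w (φ n') with hv'
  have hv'pos : 0 < ‖v'‖ := hpos _
  have hv'big : 2 * (8 / α + 2) * ‖v‖ ≤ ‖v'‖ := by
    have h1 : (n2 : ℝ) ≤ φ n' := by
      exact_mod_cast (le_max_right n0 n2).trans (hφ.id_le n')
    have h2 := hw (φ n')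
    linarith
  have hclose : ‖(‖v'‖)⁻¹ • v' - (‖v‖)⁻¹ • v‖ < α / 8 := by
    have := hn0 n' (le_max_left _ _) n (le_max_left _ _)
    rwa [dist_eq_norm] at this
  set N := ⌊‖v'‖ / (2 * ‖v‖)⌋₊ with hN
  have hN1 : (N : ℝ) ≤ ‖v'‖ / (2 * ‖v‖) := Nat.floor_le (by positivity)
  have hN2 : ‖v'‖ / (2 * ‖v‖) < N + 1 := Nat.lt_floor_add_one _
  have hN1' : 2 * N * ‖v‖ ≤ ‖v'‖ := by
    rw [le_div_iff₀ (by positivity)] at hN1; linarith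
  have hN2' : ‖v'‖ < 2 * (N + 1) * ‖v‖ := by
    rw [div_lt_iff₀ (by positivity)] at hN2; linarith
  have hNbig : 8 / α + 1 < N := by
    have : 2 * (8 / α + 2) * ‖v‖ < 2 * (N + 1) * ‖v‖ := hv'big.trans_lt hN2'
    have := lt_of_mul_lt_mul_right this hvpos.le
    linarith
  have hN0 : (1 : ℝ) < N := by
    have : 0 < 8 / α := by positivity
    linarith
  have hmain := h v (hwV _) v' (hwV _) N (by exact_mod_cast hN0.le)
  have hdiff : ‖v' - (2 * N : ℝ) • v‖ ≤ α / 8 * ‖v'‖ + 2 * ‖v‖ := by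
    have e : v' - (2 * N : ℝ) • v = ‖v'‖ • ((‖v'‖)⁻¹ • v' - (‖v‖)⁻¹ • v) +
        (‖v'‖ / ‖v‖ - 2 * N) • v := by
      rw [smul_sub, smul_smul, smul_smul, mul_inv_cancel₀ hv'pos.ne', one_smul, sub_smul,
        div_eq_mul_inv]
      abel
    rw [e]
    refine (norm_add_le _ _).trans (add_le_add ?_ ?_)
    · rw [norm_smul, norm_norm, mul_comm]
      gcongr
    · rw [norm_smul, Real.norm_eq_abs, abs_of_nonneg]
      · gcongr
        rw [sub_le_iff_le_add, div_le_iff₀ hvpos]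
        linarith
      · rw [sub_nonneg, le_div_iff₀ hvpos]; linarith
  have hCv : 4 * C ≤ α * ‖v‖ := by
    rw [div_le_iff₀ hα] at hvbig; linarith
  have hαN : 8 + α < α * N := by
    have := mul_lt_mul_of_pos_left hNbig hα
    rw [mul_add, mul_div_cancel₀ _ hα.ne'] at this
    linarith
  have s1 : α / 8 * ‖v'‖ ≤ α / 8 * (2 * (N + 1) * ‖v‖) := by gcongr
  have s2 : 4 * C * N ≤ α * ‖v‖ * N := by gcongr
  have s3 : (8 + α) * ‖v‖ < α * N * ‖v‖ := by gcongr
  have s4 : 0 < α * ‖v‖ := by positivity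
  nlinarith

section core
variable {K : Type*} [Field K] {ι : Type*} [Fintype ι]

theorem log_max_one {t : ℝ} (ht : 0 < t) : max 1 t = Real.exp (max 0 (Real.log t)) := by
  rw [Real.exp_monotone.map_max, Real.exp_zero, Real.exp_log ht]

theorem local_bound [CharZero K] (v : AbsoluteValue K ℝ) (N : ℕ) (hN : 1 ≤ N) (x x' : K)
    (hx0 : x ≠ 0) (hx1 : 1 - x ≠ 0) (hx0' : x' ≠ 0) (hx1' : 1 - x' ≠ 0) (P Q R : ℤ[X])
    (hP : Nice N P) (hQ : Nice N Q) (hR : Nice N R)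
    (hid : x ^ (2 * N) * aeval x P + (1 - x) ^ (2 * N) * aeval (1 - x) Q = aeval x R)
    (hne : aeval x P - aeval x R * (x' / x ^ (2 * N)) ≠ 0) :
    Real.log (v (aeval x P - aeval x R * (x' / x ^ (2 * N)))) ≤
      N * Real.log 512 + N * max 0 (Real.log (v x)) +
      max 0 (max (Real.log (v x') - 2 * N * Real.log (v x))
        (Real.log (v (1 - x')) - 2 * N * Real.log (v (1 - x)))) -
      2 * N * max 0 (Real.log (v x) - Real.log (v (1 - x))) := by
  set θ := aeval x P - aeval x R * (x' / x ^ (2 * N)) with hθ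
  set ξ := x' / x ^ (2 * N) with hξ
  set η := (1 - x') / (1 - x) ^ (2 * N) with hη
  set m := max 0 (max (Real.log (v x') - 2 * N * Real.log (v x))
        (Real.log (v (1 - x')) - 2 * N * Real.log (v (1 - x)))) with hm
  set g := max 0 (Real.log (v x)) with hg
  have px : 0 < v x := v.pos hx0
  have py : 0 < v (1 - x) := v.pos hx1
  have px' : 0 < v x' := v.pos hx0'
  have py' : 0 < v (1 - x') := v.pos hx1'
  have pθ : 0 < v θ := v.pos hne
  have lξ : Real.log (v ξ) = Real.log (v x') - 2 * N * Real.log (v x) := by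
    rw [hξ, map_div₀, map_pow, Real.log_div px'.ne' (by positivity), Real.log_pow]; push_cast; ring
  have lη : Real.log (v η) = Real.log (v (1 - x')) - 2 * N * Real.log (v (1 - x)) := by
    rw [hη, map_div₀, map_pow, Real.log_div py'.ne' (by positivity), Real.log_pow]; push_cast; ring
  have pξ : 0 < v ξ := v.pos (by rw [hξ]; positivity)
  have pη : 0 < v η := v.pos (by rw [hη]; exact div_ne_zero hx1' (pow_ne_zero _ hx1))
  have bξ : v ξ ≤ Real.exp m := by
    rw [← Real.exp_log pξ, Real.exp_le_exp, lξ, hm]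
    exact (le_max_left _ _).trans (le_max_right _ _)
  have bη : v η ≤ Real.exp m := by
    rw [← Real.exp_log pη, Real.exp_le_exp, lη, hm]
    exact (le_max_right _ _).trans (le_max_right _ _)
  have bm : 1 ≤ Real.exp m := Real.one_le_exp (le_max_left _ _)
  have bX : max 1 (v x) = Real.exp g := log_max_one px
  have bX1 : 1 ≤ Real.exp g := Real.one_le_exp (le_max_left _ _)
  have by1 : max 1 (v (1 - x)) ≤ 2 * Real.exp g := by
    apply max_le
    · linarith
    · have : v (1 - x) ≤ v 1 + v x := by simpa [sub_eq_add_neg] using v.add_le 1 (-x)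
      rw [map_one] at this
      have h2 : v x ≤ Real.exp g := bX ▸ le_max_right _ _
      linarith
  have bP := hP.bound v x
  have bR := hR.bound v x
  have bQ := hQ.bound v (1 - x)
  rw [bX] at bP bR
  have bQ' : v (aeval (1 - x) Q) ≤ 256 ^ N * Real.exp g ^ N := by
    calc _ ≤ _ := bQ
      _ ≤ 128 ^ N * (2 * Real.exp g) ^ N := by gcongr
      _ = _ := by rw [mul_pow, ← mul_assoc, ← mul_pow]; norm_num
  have two : (2:ℝ) ≤ 2 ^ N := by
    calc (2:ℝ) = 2 ^ 1 := by norm_num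
      _ ≤ 2 ^ N := pow_le_pow_right₀ (by norm_num) hN
  have h512 : (2:ℝ) ^ N * 256 ^ N = 512 ^ N := by rw [← mul_pow]; norm_num
  have h128 : (128:ℝ) ^ N ≤ 256 ^ N := by gcongr; norm_num
  set Z := Real.exp g ^ N with hZ
  have pZ : 0 < Z := by positivity
  have sub_le : ∀ a b : K, v (a - b) ≤ v a + v b := fun a b => by
    simpa [sub_eq_add_neg] using v.add_le a (-b)
  have ineq1 : v θ ≤ 512 ^ N * Z * Real.exp m := by
    calc v θ ≤ v (aeval x P) + v (aeval x R * ξ) := sub_le _ _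
      _ ≤ 256 ^ N * Z * Real.exp m + 256 ^ N * Z * Real.exp m := by
        rw [map_mul]
        gcongr
        · calc _ ≤ 128 ^ N * Z := bP
            _ ≤ 256 ^ N * Z * 1 := by rw [mul_one]; gcongr
            _ ≤ _ := by gcongr
        · exact bR.trans (by gcongr)
      _ = 2 * (256 ^ N * Z * Real.exp m) := by ring
      _ ≤ 2 ^ N * (256 ^ N * Z * Real.exp m) := by gcongr
      _ = _ := by rw [← h512]; ring
  have idθ : x ^ (2 * N) * θ = (1 - x) ^ (2 * N) * (aeval x R * η - aeval (1 - x) Q) := by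
    have e1 : x ^ (2 * N) * ξ = x' := by rw [hξ]; field_simp
    have e2 : (1 - x) ^ (2 * N) * η = 1 - x' := by rw [hη]; field_simp
    rw [hθ]
    linear_combination hid - aeval x R * e1 - aeval x R * e2
  have ineq2 : v x ^ (2 * N) * v θ ≤ v (1 - x) ^ (2 * N) * (512 ^ N * Z * Real.exp m) := by
    rw [← map_pow, ← map_mul, idθ, map_mul, map_pow]
    gcongr
    calc _ ≤ v (aeval x R * η) + v (aeval (1 - x) Q) := sub_le _ _
      _ ≤ 256 ^ N * Z * Real.exp m + 256 ^ N * Z * Real.exp m := by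
        rw [map_mul]
        gcongr
        · exact bR.trans (by gcongr)
        · calc _ ≤ 256 ^ N * Z * 1 := by rw [mul_one]; exact bQ'
            _ ≤ _ := by gcongr
      _ = 2 * (256 ^ N * Z * Real.exp m) := by ring
      _ ≤ 2 ^ N * (256 ^ N * Z * Real.exp m) := by gcongr
      _ = _ := by rw [← h512]; ring
  have llog : Real.log (512 ^ N * Z * Real.exp m) = N * Real.log 512 + N * g + m := by
    rw [Real.log_mul (by positivity) (by positivity), Real.log_mul (by positivity) (by positivity),
      Real.log_pow, hZ, Real.log_pow, Real.log_exp, Real.log_exp]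
  have l1 := Real.log_le_log pθ ineq1
  have l2 := Real.log_le_log (by positivity) ineq2
  rw [Real.log_mul (by positivity) (by positivity), Real.log_mul (by positivity) (by positivity),
    Real.log_pow, Real.log_pow, llog] at l2
  rw [llog] at l1
  push_cast at l2
  rcases max_choice 0 (Real.log (v x) - Real.log (v (1 - x))) with h | h <;> rw [h] <;> linarith

theorem key [CharZero K] (v : ι → AbsoluteValue K ℝ) (e : ι → ℝ) (he : ∀ i, 0 ≤ e i)
    (R : Subring K) (hR : ∀ θ ∈ R, θ ≠ 0 → 0 ≤ ∑ i, e i * Real.log (v i θ))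
    (x x' : K) (hx0 : x ≠ 0) (hx1 : 1 - x ≠ 0) (hx0' : x' ≠ 0) (hx1' : 1 - x' ≠ 0)
    (hx : x ∈ R) (hxi : x⁻¹ ∈ R) (hy : 1 - x ∈ R) (hyi : (1 - x)⁻¹ ∈ R) (hx' : x' ∈ R)
    (N : ℕ) (hN : 1 ≤ N) :
    N * ∑ i, e i * max 0 (Real.log (v i x)) ≤
      ∑ i, e i * max 0 (max (Real.log (v i x') - 2 * N * Real.log (v i x))
        (Real.log (v i (1 - x')) - 2 * N * Real.log (v i (1 - x)))) +
      (∑ i, e i) * (Real.log 512 + 2 * Real.log 2) * N := by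
  obtain ⟨P, Q, T, nP, nQ, nT, hid, hne⟩ := pade N hN x (x' / x ^ (2 * N))
    (fun h => hx1 (by rw [h, sub_self]))
  have hmem : ∀ P : ℤ[X], aeval x P ∈ R := fun P => by
    rw [aeval_eq_sum_range]
    exact R.sum_mem fun i _ => R.zsmul_mem (R.pow_mem hx _) _
  have hθ := hR (aeval x P - aeval x T * (x' / x ^ (2 * N)))
    (R.sub_mem (hmem _) (R.mul_mem (hmem _) (by
      rw [div_eq_mul_inv, ← inv_pow]; exact R.mul_mem hx' (R.pow_mem hxi _)))) hne
  have hy0 : ∑ i, e i * Real.log (v i (1 - x)) = 0 := by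
    apply le_antisymm
    · have := hR _ hyi (inv_ne_zero hx1)
      simp only [map_inv₀, Real.log_inv, mul_neg, Finset.sum_neg_distrib] at this
      linarith
    · exact hR _ hy hx1
  have hloc : ∀ i, e i * Real.log (v i (aeval x P - aeval x T * (x' / x ^ (2 * N)))) ≤
      e i * max 0 (max (Real.log (v i x') - 2 * N * Real.log (v i x))
        (Real.log (v i (1 - x')) - 2 * N * Real.log (v i (1 - x)))) +
      e i * (Real.log 512 + 2 * Real.log 2) * N - N * (e i * max 0 (Real.log (v i x))) +
      2 * N * (e i * Real.log (v i (1 - x))) := by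
    intro i
    have h1 := local_bound (v i) N hN x x' hx0 hx1 hx0' hx1' P Q T nP nQ nT hid hne
    have px : 0 < v i x := (v i).pos hx0
    have py : 0 < v i (1 - x) := (v i).pos hx1
    have h2 : max 0 (Real.log (v i x)) - Real.log 2 + - Real.log (v i (1 - x)) ≤
        max 0 (Real.log (v i x) - Real.log (v i (1 - x))) := by
      have hl2 : 0 < Real.log 2 := Real.log_pos (by norm_num)
      have h1 : 1 ≤ v i x + v i (1 - x) := by
        have := (v i).add_le x (1 - x)
        rwa [add_sub_cancel, map_one] at this
      have : 0 ≤ Real.log 2 + max (Real.log (v i x)) (Real.log (v i (1 - x))) := by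
        rcases le_total (v i x) (v i (1 - x)) with h | h
        · have : 0 ≤ Real.log (2 * v i (1 - x)) := Real.log_nonneg (by linarith)
          rw [Real.log_mul (by norm_num) py.ne'] at this
          exact this.trans (by gcongr; exact le_max_right _ _)
        · have : 0 ≤ Real.log (2 * v i x) := Real.log_nonneg (by linarith)
          rw [Real.log_mul (by norm_num) px.ne'] at this
          exact this.trans (by gcongr; exact le_max_left _ _)
      rcases max_cases 0 (Real.log (v i x)) with h | h <;>
      rcases max_cases 0 (Real.log (v i x) - Real.log (v i (1 - x))) with h' | h' <;>
      rcases max_cases (Real.log (v i x)) (Real.log (v i (1 - x))) with h'' | h'' <;> linarith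
    have hN0 : (0:ℝ) ≤ 2 * N := by positivity
    have h3 := mul_le_mul_of_nonneg_left h2 hN0
    have h4 := mul_le_mul_of_nonneg_left (h1.trans (sub_le_sub_left h3 _)) (he i)
    refine h4.trans (le_of_eq ?_)
    ring
  have hsum := hθ.trans (Finset.sum_le_sum fun i _ => hloc i)
  rw [Finset.sum_add_distrib, Finset.sum_sub_distrib, Finset.sum_add_distrib, ← Finset.mul_sum,
    ← Finset.mul_sum, hy0, ← Finset.sum_mul, ← Finset.sum_mul] at hsum
  linarith

theorem core_finite [CharZero K] (v : ι → AbsoluteValue K ℝ) (e : ι → ℝ) (he : ∀ i, 1 ≤ e i)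
    (R : Subring K) (hR : ∀ θ ∈ R, θ ≠ 0 → 0 ≤ ∑ i, e i * Real.log (v i θ))
    (hfin : ∀ B : ℝ, {x | x ∈ R ∧ ∀ i, v i x ≤ B}.Finite) :
    {x : K | x ≠ 0 ∧ 1 - x ≠ 0 ∧ x ∈ R ∧ x⁻¹ ∈ R ∧ (1 - x)⁻¹ ∈ R}.Finite := by
  set T := {x : K | x ≠ 0 ∧ 1 - x ≠ 0 ∧ x ∈ R ∧ x⁻¹ ∈ R ∧ (1 - x)⁻¹ ∈ R} with hT
  let L : K → ι → ℝ × ℝ := fun x i => (Real.log (v i x), Real.log (v i (1 - x)))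
  have he0 : ∀ i, 0 ≤ e i := fun i => by linarith [he i]
  set E₀ := ∑ i, e i with hE₀
  have hE₀0 : 0 ≤ E₀ := Finset.sum_nonneg fun i _ => he0 i
  have hl2 : 0 < Real.log 2 := Real.log_pos (by norm_num)
  have hl512 : 0 < Real.log 512 := Real.log_pos (by norm_num)
  have hunit : ∀ z : K, z ≠ 0 → z ∈ R → z⁻¹ ∈ R → ∑ i, e i * Real.log (v i z) = 0 := by
    intro z hz hzR hzi
    apply le_antisymm
    · have := hR _ hzi (inv_ne_zero hz)
      simp only [map_inv₀, Real.log_inv, mul_neg, Finset.sum_neg_distrib] at this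
      linarith
    · exact hR _ hzR hz
  have habs : ∀ z : K, z ≠ 0 → z ∈ R → z⁻¹ ∈ R → ∀ i,
      |Real.log (v i z)| ≤ 2 * ∑ i, e i * max 0 (Real.log (v i z)) := by
    intro z hz hzR hzi i
    have h1 : ∑ i, e i * |Real.log (v i z)| = 2 * ∑ i, e i * max 0 (Real.log (v i z)) := by
      have h0 := hunit z hz hzR hzi
      have : ∀ i, e i * |Real.log (v i z)| =
          2 * (e i * max 0 (Real.log (v i z))) - e i * Real.log (v i z) := by
        intro i
        rcases max_cases 0 (Real.log (v i z)) with h | h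
        · rw [h.1, abs_of_nonpos h.2]; ring
        · rw [h.1, abs_of_pos h.2]; ring
      simp_rw [this]
      rw [Finset.sum_sub_distrib, h0, Finset.mul_sum, sub_zero]
    rw [← h1]
    calc |Real.log (v i z)| ≤ e i * |Real.log (v i z)| :=
          le_mul_of_one_le_left (abs_nonneg _) (he i)
      _ ≤ _ := Finset.single_le_sum (f := fun i => e i * |Real.log (v i z)|)
          (fun j _ => mul_nonneg (he0 j) (abs_nonneg _)) (Finset.mem_univ i)
  have hnorm : ∀ x ∈ T, ‖L x‖ ≤ 2 * ∑ i, e i * max 0 (Real.log (v i x)) + 2 * E₀ * Real.log 2 := by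
    rintro x ⟨hx0, hx1, hx, hxi, hyi⟩
    have hy : 1 - x ∈ R := R.sub_mem R.one_mem hx
    have hnn : 0 ≤ ∑ i, e i * max 0 (Real.log (v i x)) :=
      Finset.sum_nonneg fun i _ => mul_nonneg (he0 i) (le_max_left _ _)
    rw [pi_norm_le_iff_of_nonneg (by positivity)]
    intro i
    rw [Prod.norm_def, max_le_iff, Real.norm_eq_abs, Real.norm_eq_abs]
    constructor
    · have := habs x hx0 hx hxi i
      have : 0 ≤ 2 * E₀ * Real.log 2 := by positivity
      simp only [L]
      linarith
    · refine (habs (1 - x) hx1 hy hyi i).trans ?_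
      rw [mul_assoc 2, ← mul_add, hE₀, Finset.sum_mul, ← Finset.sum_add_distrib]
      gcongr with j _
      rw [← mul_add]
      refine mul_le_mul_of_nonneg_left ?_ (he0 j)
      have px : 0 < v j x := (v j).pos hx0
      have py : 0 < v j (1 - x) := (v j).pos hx1
      rw [← Real.exp_le_exp, Real.exp_add, ← log_max_one px, ← log_max_one py,
        Real.exp_log (by norm_num)]
      have : v j (1 - x) ≤ v j 1 + v j x := by simpa [sub_eq_add_neg] using (v j).add_le 1 (-x)
      rw [map_one] at this
      apply max_le
      · have := le_max_left 1 (v j x); linarith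
      · have := le_max_left 1 (v j x)
        have := le_max_right 1 (v j x); linarith
  obtain ⟨B, hB⟩ := gap (L '' T) (1 / (2 * (E₀ + 1)))
    (E₀ * (Real.log 512 + 3 * Real.log 2)) (by positivity) (by positivity) (by
      rintro _ ⟨x, hx, rfl⟩ _ ⟨x', hx', rfl⟩ N hN
      have h1 := hnorm x hx
      obtain ⟨hx0, hx1, hx, hxi, hyi⟩ := hx
      obtain ⟨hx0', hx1', hx', hxi', hyi'⟩ := hx'
      have h2 := key v e he0 R hR x x' hx0 hx1 hx0' hx1' hx hxi (R.sub_mem R.one_mem hx) hyi hx'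
        N hN
      set D := ‖L x' - (2 * N : ℝ) • L x‖ with hD
      have h3 : ∑ i, e i * max 0 (max (Real.log (v i x') - 2 * N * Real.log (v i x))
          (Real.log (v i (1 - x')) - 2 * N * Real.log (v i (1 - x)))) ≤ E₀ * D := by
        rw [hE₀, Finset.sum_mul]
        refine Finset.sum_le_sum fun i _ => mul_le_mul_of_nonneg_left ?_ (he0 i)
        have hi := norm_le_pi_norm (L x' - (2 * N : ℝ) • L x) i
        rw [Prod.norm_def, max_le_iff] at hi
        refine max_le (norm_nonneg _) (max_le ?_ ?_)
        · exact (le_abs_self _).trans hi.1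
        · exact (le_abs_self _).trans hi.2
      have hD0 : 0 ≤ D := norm_nonneg _
      have hN' : (1:ℝ) ≤ N := by exact_mod_cast hN
      set H := ∑ i, e i * max 0 (Real.log (v i x)) with hH
      have h4 : N * ‖L x‖ ≤ N * (2 * H + 2 * E₀ * Real.log 2) := by gcongr
      have h5 : N * ‖L x‖ ≤ 2 * (E₀ + 1) * (D + E₀ * (Real.log 512 + 3 * Real.log 2) * N) := by
        have : 0 ≤ 2 * E₀ * (E₀ * (Real.log 512 + 3 * Real.log 2) * N) := by positivity
        nlinarith
      calc 1 / (2 * (E₀ + 1)) * N * ‖L x‖ = (N * ‖L x‖) / (2 * (E₀ + 1)) := by ring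
        _ ≤ _ := by rw [div_le_iff₀ (by positivity)]; linarith)
  refine (hfin (Real.exp B)).subset ?_
  intro x hx
  refine ⟨hx.2.2.1, fun i => ?_⟩
  have h1 := (norm_le_pi_norm (L x) i).trans (hB _ ⟨x, hx, rfl⟩)
  rw [Prod.norm_def, max_le_iff] at h1
  rw [← Real.exp_log ((v i).pos hx.1), Real.exp_le_exp]
  exact (le_abs_self _).trans h1.1

end core
end SUnitAux
end Part3

section Part4
namespace SUnitAux
open NumberField IsDedekindDomain

variable {L : Type*} [Field L] [NumberField L]

theorem place_le_one (v : HeightOneSpectrum (𝓞 L)) (x : L) (h : v.valuation L x ≤ 1) :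
    FinitePlace.mk v x ≤ 1 := by
  rw [FinitePlace.mk_apply, FinitePlace.norm_embedding']
  have := (WithZeroMulInt.toNNReal_strictMono (HeightOneSpectrum.one_lt_absNorm_nnreal v)).monotone h
  rw [map_one] at this
  exact_mod_cast this

theorem finprod_le (S : Set (HeightOneSpectrum (𝓞 L))) [Fintype S] (f : FinitePlace L → ℝ)
    (hf : f.mulSupport.Finite) (h0 : ∀ w, 0 ≤ f w) (h1 : ∀ v ∉ S, f (FinitePlace.mk v) ≤ 1) :
    ∏ᶠ w, f w ≤ ∏ s : S, f (FinitePlace.mk s.1) := by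
  classical
  have hinj : Function.Injective (fun s : S => FinitePlace.mk s.1) := by
    intro a b hab
    exact Subtype.ext (FinitePlace.mk_eq_iff.mp hab)
  set A : Finset (FinitePlace L) := Finset.univ.image (fun s : S => FinitePlace.mk s.1) with hA
  have e1 : ∏ s : S, f (FinitePlace.mk s.1) = ∏ w ∈ A, f w := by
    rw [hA, Finset.prod_image (fun a _ b _ h => hinj h)]
  rw [e1, finprod_eq_prod_of_mulSupport_subset f (s := hf.toFinset ∪ A) (by simp),
    ← Finset.prod_sdiff (s₁ := A) Finset.subset_union_right]
  refine mul_le_of_le_one_left (Finset.prod_nonneg fun w _ => h0 w) ?_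
  refine Finset.prod_le_one (fun w _ => h0 w) fun w hw => ?_
  rw [Finset.mem_sdiff] at hw
  rw [← FinitePlace.mk_maximalIdeal w]
  apply h1
  intro hS
  apply hw.2
  rw [hA, Finset.mem_image]
  exact ⟨⟨_, hS⟩, Finset.mem_univ _, FinitePlace.mk_maximalIdeal w⟩

theorem sunit_finite (S : Set (HeightOneSpectrum (𝓞 L))) (hS : S.Finite) :
    {x : L | x ≠ 0 ∧ 1 - x ≠ 0 ∧ x ∈ S.integer L ∧ x⁻¹ ∈ S.integer L ∧
      (1 - x)⁻¹ ∈ S.integer L}.Finite := by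
  have : Fintype S := hS.fintype
  refine core_finite (ι := InfinitePlace L ⊕ S)
    (Sum.elim (fun w => w.1) (fun s => (FinitePlace.mk s.1).1))
    (Sum.elim (fun w => (w.mult : ℝ)) (fun _ => 1)) ?_ (S.integer L).toSubring ?_ ?_
  · rintro (w | s)
    · exact Nat.one_le_cast.mpr w.mult_pos
    · simp
  · intro θ hθ h0
    have hprod := prod_abs_eq_one h0
    have hle := finprod_le S (fun w => w θ) (FinitePlace.hasFiniteMulSupport h0)
      (fun w => apply_nonneg w θ) (fun v hv => place_le_one v θ (hθ v hv))
    have hpos : 0 < ∏ w : InfinitePlace L, w θ ^ w.mult :=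
      Finset.prod_pos fun w _ => pow_pos (InfinitePlace.pos_iff.mpr h0) _
    have hpos2 : 0 < ∏ s : S, FinitePlace.mk s.1 θ :=
      Finset.prod_pos fun s _ => FinitePlace.pos_iff.mpr h0
    have h1 : 1 ≤ (∏ w : InfinitePlace L, w θ ^ w.mult) * ∏ s : S, FinitePlace.mk s.1 θ := by
      rw [← hprod]; gcongr
    have h2 := Real.log_nonneg h1
    rw [Real.log_mul hpos.ne' hpos2.ne', Real.log_prod (fun w _ =>
      (pow_pos (InfinitePlace.pos_iff.mpr h0) _).ne'), Real.log_prod (fun s _ =>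
      (FinitePlace.pos_iff.mpr h0).ne')] at h2
    simp only [Real.log_pow] at h2
    simpa [Fintype.sum_sum_type] using! h2
  · intro B
    refine (Northcott.finite_le (h := Height.mulHeight₁ (K := L))
      ((∏ w : InfinitePlace L, max B 1 ^ w.mult) * ∏ s : S, max B 1)).subset ?_
    rintro x ⟨hx, hB⟩
    have hB1 : ∀ w : InfinitePlace L, w x ≤ B := fun w => hB (Sum.inl w)
    have hB2 : ∀ s : S, FinitePlace.mk s.1 x ≤ B := fun s => hB (Sum.inr s)
    show Height.mulHeight₁ x ≤ _
    rw [NumberField.mulHeight₁_eq]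
    rcases eq_or_ne x 0 with rfl | h0
    · simp only [map_zero, zero_le_one, sup_of_le_right, one_pow, Finset.prod_const_one,
        finprod_one, mul_one]
      refine one_le_mul_of_one_le_of_one_le ?_ ?_
      · simpa using Finset.prod_le_prod (s := Finset.univ) (f := fun _ : InfinitePlace L => (1:ℝ))
          (g := fun w => max B 1 ^ w.mult) (fun _ _ => zero_le_one)
          (fun w _ => one_le_pow₀ (le_max_right _ _))
      · simpa only [Finset.prod_const_one] using Finset.prod_le_prod (s := Finset.univ)
          (f := fun _ : S => (1:ℝ))
          (g := fun _ => max B 1) (fun _ _ => zero_le_one) (fun w _ => le_max_right _ _)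
    have hle := finprod_le S (fun w => max (w x) 1)
      ((FinitePlace.hasFiniteMulSupport h0).subset (by
        intro w hw h
        apply hw
        simp only at h ⊢
        rw [h, max_self]))
      (fun w => zero_le_one.trans (le_max_right _ _))
      (fun v hv => max_le (place_le_one v x (hx v hv)) le_rfl)
    gcongr
    · exact finprod_nonneg fun w => zero_le_one.trans (le_max_right _ _)
    · exact hB1 _
    · refine hle.trans ?_
      gcongr with s
      exact hB2 s

end SUnitAux
end Part4

section Part5
open scoped MatrixGroups
open NumberField IsDedekindDomain

namespace SUnitAux

theorem pow_formula {F : Type*} [Field F] (B : Matrix (Fin 2) (Fin 2) F) (hdet : B.det = 1)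
    (l u : F) (hlu : l * u = 1) (htr : B.trace = l + u) (n : ℕ) :
    (l - u) • B ^ (n + 1) = (l ^ (n + 1) - u ^ (n + 1)) • B - (l ^ n - u ^ n) • (1 : Matrix (Fin 2) (Fin 2) F) := by
  have hB : B * B = (l + u) • B - (1 : Matrix (Fin 2) (Fin 2) F) := by
    rw [Matrix.det_fin_two] at hdet
    rw [Matrix.trace_fin_two] at htr
    rw [← htr]
    ext i j
    fin_cases i <;> fin_cases j <;> simp [Matrix.mul_apply, Fin.sum_univ_two] <;>
      first | linear_combination (-1 : F) * hdet | ring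
  induction n with
  | zero => simp
  | succ n ih =>
    rw [pow_succ, ← smul_mul_assoc, ih, sub_mul, smul_mul_assoc, hB, smul_mul_assoc, one_mul,
      smul_sub, smul_smul]
    have h1 : (l ^ (n + 1) - u ^ (n + 1)) * (l + u) = (l ^ (n + 2) - u ^ (n + 2)) + (l ^ n - u ^ n) := by
      linear_combination (l ^ n - u ^ n) * hlu
    rw [h1, add_smul]
    abel

theorem order_psl {k F : Type*} [Field k] [Field F] (f : k →+* F) (A : SL(2, k)) (l u : F)
    (hlu : l * u = 1) (m : ℕ) (hm : 1 < m) (hl : IsPrimitiveRoot (l ^ 2) m)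
    (htr : f (Matrix.trace (A : Matrix (Fin 2) (Fin 2) k)) = l + u) :
    orderOf (QuotientGroup.mk A : PSL(2, k)) = m := by
  set B : Matrix (Fin 2) (Fin 2) F := f.mapMatrix (A : Matrix (Fin 2) (Fin 2) k) with hBdef
  have hdet : B.det = 1 := by
    rw [hBdef, ← RingHom.map_det]; simp
  have htr' : B.trace = l + u := by
    rw [← htr, Matrix.trace_fin_two, Matrix.trace_fin_two, map_add]; simp [hBdef]
  have hl0 : l ≠ 0 := left_ne_zero_of_mul_eq_one hlu
  have hl1 : l ^ 2 ≠ 1 := hl.ne_one hm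
  have hne : l - u ≠ 0 := by
    intro h
    apply hl1
    linear_combination hlu + l * h
  have hpow : ∀ n : ℕ, B ^ n = f.mapMatrix ((A ^ n : SL(2, k)) : Matrix (Fin 2) (Fin 2) k) := by
    intro n; rw [hBdef, ← map_pow]; simp
  have key : ∀ n : ℕ, A ^ n ∈ Subgroup.center (SL(2, k)) ↔ m ∣ n := by
    intro n
    rw [← hl.pow_eq_one_iff_dvd]
    rcases n with _ | n
    · simp
    have hf := pow_formula B hdet l u hlu htr' n
    rw [Matrix.SpecialLinearGroup.mem_center_iff]
    constructor
    · rintro ⟨r, hr, hrA⟩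
      have hBr : B ^ (n + 1) = f r • (1 : Matrix (Fin 2) (Fin 2) F) := by
        rw [hpow, ← hrA]
        ext i j
        fin_cases i <;> fin_cases j <;> simp
      by_cases hc : l ^ (n + 1) - u ^ (n + 1) = 0
      · have : (l * u) ^ (n + 1) = 1 := by rw [hlu, one_pow]
        rw [mul_pow] at this
        rw [← pow_mul, mul_comm, pow_mul]
        linear_combination this + l ^ (n + 1) * hc
      · exfalso
        rw [hBr] at hf
        have h01 := congrFun (congrFun hf 0) 1
        have h10 := congrFun (congrFun hf 1) 0
        have h00 := congrFun (congrFun hf 0) 0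
        have h11 := congrFun (congrFun hf 1) 1
        simp at h01 h10 h00 h11
        have e01 : B 0 1 = 0 := by tauto
        have e : B 0 0 = B 1 1 := by
          apply mul_left_cancel₀ hc
          linear_combination h11 - h00
        rw [Matrix.det_fin_two, e01, e] at hdet
        rw [Matrix.trace_fin_two, e] at htr'
        have : (l - u) ^ 2 = 0 := by
          linear_combination 4 * hdet - 4 * hlu - (B 1 1 + B 1 1 + l + u) * htr'
        exact hne (by simpa using this)
    · intro h
      have h1 : l ^ (n + 1) = u ^ (n + 1) := by
        have h2 : (l * u) ^ (n + 1) = 1 := by rw [hlu, one_pow]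
        rw [mul_pow] at h2
        rw [← pow_mul, mul_comm, pow_mul] at h
        apply mul_left_cancel₀ (pow_ne_zero (n + 1) hl0)
        linear_combination h - h2
      rw [h1, sub_self, zero_smul, zero_sub] at hf
      have h01 := congrFun (congrFun hf 0) 1
      have h10 := congrFun (congrFun hf 1) 0
      have h00 := congrFun (congrFun hf 0) 0
      have h11 := congrFun (congrFun hf 1) 1
      rw [hpow] at h01 h10 h00 h11
      simp [hne] at h01 h10
      have e : (A ^ (n + 1) : SL(2, k)) 0 0 = (A ^ (n + 1) : SL(2, k)) 1 1 := by
        apply f.injective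
        simp at h00 h11
        simp
        apply mul_left_cancel₀ hne
        linear_combination h00 - h11
      have hd := (A ^ (n + 1)).det_coe
      rw [Matrix.det_fin_two] at hd
      have h01' : (A ^ (n + 1) : SL(2, k)) 0 1 = 0 := by simpa using h01
      have h10' : (A ^ (n + 1) : SL(2, k)) 1 0 = 0 := by simpa using h10
      refine ⟨(A ^ (n + 1) : SL(2, k)) 1 1, ?_, ?_⟩
      · rw [e, h01'] at hd
        simp only [Fintype.card_fin]
        linear_combination hd
      · ext i j
        fin_cases i <;> fin_cases j
        · simpa using! e.symm
        · simpa using! h01'.symm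
        · simpa using! h10'.symm
        · simp
  apply Nat.dvd_antisymm
  · rw [orderOf_dvd_iff_pow_eq_one, ← QuotientGroup.mk_pow]
    exact (QuotientGroup.eq_one_iff _).2 ((key m).2 dvd_rfl)
  · rw [← key]
    have := pow_orderOf_eq_one (QuotientGroup.mk A : PSL(2, k))
    rw [← QuotientGroup.mk_pow] at this
    exact (QuotientGroup.eq_one_iff _).1 this

variable {K : Type*} [Field K] [NumberField K]

theorem residue_finite (v : HeightOneSpectrum (𝓞 K)) :
    Finite (IsLocalRing.ResidueField (HeightOneSpectrum.valuation (K := K) v).valuationSubring) := by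
  have : Finite (𝓞 K ⧸ v.asIdeal) := Ring.HasFiniteQuotients.finiteQuotient v.ne_bot
  let g : 𝓞 K →+* (HeightOneSpectrum.valuation (K := K) v).valuationSubring :=
    (algebraMap (𝓞 K) K).codRestrict (HeightOneSpectrum.valuation (K := K) v).valuationSubring
      (fun x => (Valuation.mem_valuationSubring_iff _ _).2 (v.valuation_le_one x))
  let h := (IsLocalRing.residue (HeightOneSpectrum.valuation (K := K) v).valuationSubring).comp g
  have hk : ∀ x ∈ v.asIdeal, h x = 0 := by
    intro x hx
    rw [RingHom.comp_apply, IsLocalRing.residue_eq_zero_iff, Valuation.mem_maximalIdeal_iff]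
    exact (v.valuation_lt_one_iff_mem x).2 hx
  refine Finite.of_surjective (Ideal.Quotient.lift v.asIdeal h hk) ?_
  intro y
  obtain ⟨x, rfl⟩ := IsLocalRing.residue_surjective y
  obtain ⟨a, ha⟩ := v.exists_valuation_sub_lt_of_integer (K := K) (x := (x : K)) ((Valuation.mem_valuationSubring_iff _ _).1 x.2) (γ := 1)
  refine ⟨Ideal.Quotient.mk _ a, ?_⟩
  rw [Ideal.Quotient.lift_mk, RingHom.comp_apply, ← sub_eq_zero, ← map_sub, IsLocalRing.residue_eq_zero_iff, Valuation.mem_maximalIdeal_iff]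
  simpa using! ha

end SUnitAux
end Part5

section Part6
open scoped MatrixGroups
open NumberField IsDedekindDomain

namespace SUnitAux

variable {K L : Type*} [Field K] [NumberField K] [Field L] [NumberField L] [Algebra K L]

theorem local_order (v : HeightOneSpectrum (𝓞 K)) (w : HeightOneSpectrum (𝓞 L))
    [w.asIdeal.LiesOver v.asIdeal] (ω : L) (m : ℕ) (hm : 1 < m) (hω : IsPrimitiveRoot (ω ^ 2) m)
    (hwm : w.valuation L (m : L) = 1) (t : (v.valuation K).valuationSubring)
    (ht : w.valuation L (algebraMap K L (t : K) - (ω + ω⁻¹)) < 1)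
    (A : SL(2, IsLocalRing.ResidueField (v.valuation K).valuationSubring))
    (hA : Matrix.trace (A : Matrix (Fin 2) (Fin 2) _) = IsLocalRing.residue _ t) :
    orderOf (QuotientGroup.mk A :
      PSL(2, IsLocalRing.ResidueField (v.valuation K).valuationSubring)) = m := by
  have he : v.asIdeal.ramificationIdx' w.asIdeal ≠ 0 :=
    Ideal.IsDedekindDomain.ramificationIdx'_ne_zero_of_liesOver w.asIdeal v.ne_bot
  have hval := HeightOneSpectrum.valuation_liesOver (K := K) (A := 𝓞 K) L v w
  let φ : (v.valuation K).valuationSubring →+* (w.valuation L).valuationSubring :=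
    ((algebraMap K L).comp (v.valuation K).valuationSubring.subtype).codRestrict
      (w.valuation L).valuationSubring
      (fun x => (Valuation.mem_valuationSubring_iff _ _).2 (by
        rw [RingHom.comp_apply, ← hval]
        exact pow_le_one₀ zero_le ((Valuation.mem_valuationSubring_iff _ _).1 x.2)))
  have hφ : ∀ x, ((φ x : (w.valuation L).valuationSubring) : L) = algebraMap K L (x : K) :=
    fun x => rfl
  have hloc : IsLocalHom φ := by
    refine ⟨fun x hx => ?_⟩
    by_contra hn
    have h1 : x ∈ IsLocalRing.maximalIdeal _ := (IsLocalRing.mem_maximalIdeal _).2 hn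
    rw [Valuation.mem_maximalIdeal_iff] at h1
    have h2 : φ x ∈ IsLocalRing.maximalIdeal _ := by
      rw [Valuation.mem_maximalIdeal_iff, hφ, ← hval]
      exact pow_lt_one₀ zero_le h1 he
    exact (IsLocalRing.mem_maximalIdeal _).1 h2 hx
  have hωpow : (ω ^ 2) ^ m = 1 := hω.pow_eq_one
  have hω0 : ω ≠ 0 := by
    rintro rfl
    rw [zero_pow two_ne_zero, zero_pow (by omega)] at hωpow
    exact zero_ne_one hωpow
  have hw1 : w.valuation L ω = 1 := by
    have : (w.valuation L ω) ^ (2 * m) = 1 := by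
      rw [← map_pow, pow_mul, hωpow, map_one]
    exact (pow_eq_one_iff_of_nonneg zero_le (by omega)).1 this
  let o : (w.valuation L).valuationSubring := ⟨ω, (Valuation.mem_valuationSubring_iff _ _).2 hw1.le⟩
  let o' : (w.valuation L).valuationSubring := ⟨ω⁻¹, (Valuation.mem_valuationSubring_iff _ _).2
    (by rw [map_inv₀, hw1, inv_one])⟩
  have hoo : o * o' = 1 := Subtype.ext (mul_inv_cancel₀ hω0)
  have ho : IsPrimitiveRoot (o ^ 2) m := by
    apply IsPrimitiveRoot.of_map_of_injective (f := (w.valuation L).valuationSubring.subtype) _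
      Subtype.val_injective
    simpa using! hω
  have hmk : ((m : ℕ) : IsLocalRing.ResidueField (w.valuation L).valuationSubring) ≠ 0 := by
    rw [← map_natCast (IsLocalRing.residue (w.valuation L).valuationSubring), Ne,
      IsLocalRing.residue_eq_zero_iff, Valuation.mem_maximalIdeal_iff]
    have : (((m : ℕ) : (w.valuation L).valuationSubring) : L) = (m : L) := by simp
    rw [this, hwm]
    exact lt_irrefl _
  have : NeZero ((m : ℕ) : IsLocalRing.ResidueField (w.valuation L).valuationSubring) := ⟨hmk⟩
  have hro : IsPrimitiveRoot (IsLocalRing.residue (w.valuation L).valuationSubring o ^ 2) m := by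
    rw [← Polynomial.isRoot_cyclotomic_iff, ← map_pow,
      ← Polynomial.map_cyclotomic m (IsLocalRing.residue (w.valuation L).valuationSubring)]
    exact (ho.isRoot_cyclotomic (by omega)).map
  refine order_psl (IsLocalRing.ResidueField.map φ) A
    (IsLocalRing.residue (w.valuation L).valuationSubring o)
    (IsLocalRing.residue (w.valuation L).valuationSubring o') ?_ m hm hro ?_
  · rw [← map_mul, hoo, map_one]
  · rw [hA, IsLocalRing.ResidueField.map_residue, ← map_add, ← sub_eq_zero, ← map_sub,
      IsLocalRing.residue_eq_zero_iff, Valuation.mem_maximalIdeal_iff]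
    exact ht

theorem trace_set (S : Set (HeightOneSpectrum (𝓞 K))) (hS : S.Finite) (m : ℕ) (hm : 2 < m)
    (ω : L) (hω : IsPrimitiveRoot ω (2 * m)) :
    ∃ W : Set K, W.Finite ∧ ∀ t ∈ S.integer K, t ∉ W →
      ∃ (v : HeightOneSpectrum (𝓞 K)) (w : HeightOneSpectrum (𝓞 L)) (ω' : L), v ∉ S ∧
        w.asIdeal.LiesOver v.asIdeal ∧ IsPrimitiveRoot (ω' ^ 2) m ∧
        w.valuation L (m : L) = 1 ∧ w.valuation L (algebraMap K L t - (ω' + ω'⁻¹)) < 1 := by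
  classical
  have hω2 : IsPrimitiveRoot (ω ^ 2) m := hω.pow (by omega) rfl
  have hω0 : ω ≠ 0 := hω.ne_zero (by omega)
  have hint : IsIntegral ℤ (ω + ω⁻¹) :=
    (hω.isIntegral (by omega)).add (hω.inv.isIntegral (by omega))
  obtain ⟨a, ha⟩ : ∃ a : 𝓞 L, algebraMap (𝓞 L) L a = ω + ω⁻¹ := ⟨⟨ω + ω⁻¹, hint⟩, rfl⟩
  have ha0 : ω + ω⁻¹ ≠ 0 := by
    intro h
    have h2 : ω ^ 4 = 1 := by
      field_simp at h
      linear_combination (ω ^ 2 - 1) * h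
    have := Nat.le_of_dvd (by norm_num) (hω.dvd_of_pow_eq_one 4 h2)
    omega
  have haL : a ≠ 0 := by
    rintro rfl
    rw [map_zero] at ha
    exact ha0 ha.symm
  have hs : ∀ v : HeightOneSpectrum (𝓞 K), ∃ s ∈ v.asIdeal, s ≠ 0 := fun v =>
    Submodule.exists_mem_ne_zero_of_ne_bot v.ne_bot
  choose s hsv hs0 using hs
  set n : 𝓞 L := (m : 𝓞 L) * (2 * a) * algebraMap (𝓞 K) (𝓞 L) (∏ v ∈ hS.toFinset, s v) with hn
  have hn0 : n ≠ 0 := by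
    refine mul_ne_zero (mul_ne_zero (Nat.cast_ne_zero.2 (by omega)) (mul_ne_zero two_ne_zero haL)) ?_
    rw [Ne, FaithfulSMul.algebraMap_eq_zero_iff]
    exact Finset.prod_ne_zero_iff.2 fun v _ => hs0 v
  set S' : Set (HeightOneSpectrum (𝓞 L)) := {w | w.asIdeal ∣ Ideal.span {n}} with hS'
  have hS'fin : S'.Finite := Ideal.finite_factors (by simpa using hn0)
  have hnot : ∀ w ∉ S', n ∉ w.asIdeal := by
    intro w hw h
    exact hw ((Ideal.dvd_span_singleton).2 h)
  have hval : ∀ w ∉ S', ∀ x : 𝓞 L, x ∣ n → w.valuation L (algebraMap (𝓞 L) L x) = 1 := by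
    intro w hw x hx
    rw [HeightOneSpectrum.valuation_eq_one_iff_notMem]
    intro h
    exact hnot w hw (Ideal.mem_of_dvd _ hx h)
  have hvm : ∀ w ∉ S', w.valuation L (m : L) = 1 := by
    intro w hw
    have := hval w hw (m : 𝓞 L) (Dvd.intro _ (by rw [hn, mul_assoc]))
    simpa using this
  have hva : ∀ w ∉ S', w.valuation L (2 * (ω + ω⁻¹)) = 1 := by
    intro w hw
    have := hval w hw (2 * a) ⟨(m : 𝓞 L) * algebraMap (𝓞 K) (𝓞 L) (∏ v ∈ hS.toFinset, s v), by rw [hn]; ring⟩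
    rwa [map_mul, ha, map_ofNat] at this
  have hunder : ∀ w ∉ S', ∃ v : HeightOneSpectrum (𝓞 K), v ∉ S ∧ w.asIdeal.LiesOver v.asIdeal := by
    intro w hw
    refine ⟨⟨w.asIdeal.under (𝓞 K), inferInstance, Ideal.IsIntegral.comap_ne_bot (𝓞 K) w.ne_bot⟩,
      ?_, ⟨rfl⟩⟩
    intro hv
    apply hnot w hw
    apply Ideal.mul_mem_left
    rw [← Ideal.mem_comap]
    exact Ideal.mem_of_dvd _ (Finset.dvd_prod_of_mem s (hS.mem_toFinset.2 hv))
      (hsv ⟨w.asIdeal.under (𝓞 K), inferInstance, Ideal.IsIntegral.comap_ne_bot (𝓞 K) w.ne_bot⟩)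
  have hvt : ∀ w ∉ S', ∀ t ∈ S.integer K, w.valuation L (algebraMap K L t) ≤ 1 := by
    intro w hw t ht
    obtain ⟨v, hv, hl⟩ := hunder w hw
    rw [← HeightOneSpectrum.valuation_liesOver (K := K) (A := 𝓞 K) L v w]
    exact pow_le_one₀ zero_le (ht v hv)
  have hwa : ∀ w : HeightOneSpectrum (𝓞 L), w.valuation L (ω + ω⁻¹) ≤ 1 := by
    intro w
    rw [← ha]
    exact w.valuation_le_one a
  set b : L := ω + ω⁻¹ with hb
  have hinj : Function.Injective (fun t : K => (algebraMap K L t + b) / (2 * b)) := by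
    intro x y hxy
    have h2b : (2 : L) * b ≠ 0 := mul_ne_zero two_ne_zero ha0
    have : (algebraMap K L x + b) / (2 * b) = (algebraMap K L y + b) / (2 * b) := hxy
    rw [div_left_inj' h2b] at this
    exact (algebraMap K L).injective (add_right_cancel this)
  refine ⟨(fun t : K => (algebraMap K L t + b) / (2 * b)) ⁻¹' ({0, 1} ∪ {x : L | x ≠ 0 ∧ 1 - x ≠ 0 ∧
      x ∈ S'.integer L ∧ x⁻¹ ∈ S'.integer L ∧ (1 - x)⁻¹ ∈ S'.integer L}), ?_, ?_⟩
  · exact Set.Finite.preimage hinj.injOn ((Set.toFinite _).union (sunit_finite S' hS'fin))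
  intro t ht htW
  have h2b : (2 : L) * b ≠ 0 := mul_ne_zero two_ne_zero ha0
  set x : L := (algebraMap K L t + b) / (2 * b) with hx
  have hxmem : ¬ (x ∈ ({0, 1} ∪ {x : L | x ≠ 0 ∧ 1 - x ≠ 0 ∧
      x ∈ S'.integer L ∧ x⁻¹ ∈ S'.integer L ∧ (1 - x)⁻¹ ∈ S'.integer L} : Set L)) := htW
  have h1x : 1 - x = (b - algebraMap K L t) / (2 * b) := by
    rw [hx, eq_div_iff h2b, sub_mul, div_mul_cancel₀ _ h2b]; ring
  have hx0 : x ≠ 0 := fun h => hxmem (Or.inl (Or.inl h))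
  have hx1 : 1 - x ≠ 0 := fun h => hxmem (Or.inl (Or.inr (sub_eq_zero.1 h).symm))
  have hxi : x ∈ S'.integer L := by
    intro w hw
    rw [hx, map_div₀, hva w hw, div_one]
    exact Valuation.map_add_le _ (hvt w hw t ht) (hwa w)
  have hmain : x⁻¹ ∉ S'.integer L ∨ (1 - x)⁻¹ ∉ S'.integer L := by
    by_contra hc
    rw [not_or, not_not, not_not] at hc
    exact hxmem (Or.inr ⟨hx0, hx1, hxi, hc.1, hc.2⟩)
  have hex : ∀ y : L, y ≠ 0 → y⁻¹ ∉ S'.integer L → ∃ w ∉ S', w.valuation L y < 1 := by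
    intro y hy h
    by_contra hc
    push Not at hc
    apply h
    intro w hw
    rw [map_inv₀]
    exact inv_le_one_of_one_le₀ (hc w hw)
  rcases hmain with h | h
  · obtain ⟨w, hw, hlt⟩ := hex x hx0 h
    obtain ⟨v, hv, hl⟩ := hunder w hw
    refine ⟨v, w, -ω, hv, hl, by simpa using hω2, hvm w hw, ?_⟩
    rw [hx, map_div₀, hva w hw, div_one] at hlt
    have : algebraMap K L t - (-ω + (-ω)⁻¹) = algebraMap K L t + b := by
      rw [hb, inv_neg]; ring
    rwa [this]
  · obtain ⟨w, hw, hlt⟩ := hex _ hx1 h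
    obtain ⟨v, hv, hl⟩ := hunder w hw
    refine ⟨v, w, ω, hv, hl, hω2, hvm w hw, ?_⟩
    rw [h1x, map_div₀, hva w hw, div_one, Valuation.map_sub_swap] at hlt
    exact hlt

end SUnitAux
end Part6

/-- Let `K` be a number field, `S` a finite set of nonzero primes of `𝓞 K`, and `m > 2`.
Then there is a finite set `W` of `S`-integers such that every `γ ∈ SL₂(O_{K,S})` whose
trace avoids `W` reduces, modulo some prime `v ∉ S`, to an element of `PSL₂(k_v)` of
order exactly `m`; in particular `m` is a finitistic order for `γ`. -/
theorem exists_trace_set_for_finitistic_order (S : Set (HeightOneSpectrum (𝓞 K)))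
    (hS : S.Finite) (m : ℕ) (hm : 2 < m) :
    ∃ W : Finset (S.integer K),
      ∀ γ : Matrix.SpecialLinearGroup (Fin 2) (S.integer K),
        Matrix.trace ((γ : Matrix (Fin 2) (Fin 2) (S.integer K))) ∉ W →
          (∃ (v : HeightOneSpectrum (𝓞 K)) (hv : v ∉ S),
            orderOf (QuotientGroup.mk (Matrix.SpecialLinearGroup.map
                (sIntegerReduction S v hv) γ) : PSL(2, residueFieldAt v)) = m) ∧
          FinitisticOrder m γ := by
  classical
  have hne : NeZero (2 * m) := ⟨by omega⟩
  have hnf : NumberField (CyclotomicField (2 * m) K) :=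
    IsCyclotomicExtension.numberField {2 * m} K _
  obtain ⟨W, hW, h⟩ := SUnitAux.trace_set (L := CyclotomicField (2 * m) K) S hS m hm _
    (IsCyclotomicExtension.zeta_spec (2 * m) K (CyclotomicField (2 * m) K))
  have hfin : ((fun t : S.integer K => (t : K)) ⁻¹' W).Finite :=
    hW.preimage Subtype.val_injective.injOn
  refine ⟨hfin.toFinset, fun γ hγ => ?_⟩
  rw [Set.Finite.mem_toFinset] at hγ
  obtain ⟨v, w, ω, hv, hl, hω, hwm, hlt⟩ := h _ (Matrix.trace γ.1).2 hγ
  have hord : orderOf (QuotientGroup.mk (Matrix.SpecialLinearGroup.map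
      (sIntegerReduction S v hv) γ) : PSL(2, residueFieldAt v)) = m := by
    refine SUnitAux.local_order v w ω m (by omega) hω hwm
      ⟨(Matrix.trace γ.1 : S.integer K), (Valuation.mem_valuationSubring_iff _ _).2
        (Set.integer_valuation_le_one S K _ hv)⟩ hlt _ ?_
    have : Matrix.trace ((Matrix.SpecialLinearGroup.map (sIntegerReduction S v hv) γ :
        SL(2, residueFieldAt v)) : Matrix (Fin 2) (Fin 2) (residueFieldAt v)) =
        sIntegerReduction S v hv (Matrix.trace γ.1) := by
      rw [Matrix.trace_fin_two, Matrix.trace_fin_two, map_add]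
      rfl
    rw [this]
    rfl
  refine ⟨⟨v, hv, hord⟩, ?_⟩
  have hF : Finite (residueFieldAt v) := SUnitAux.residue_finite v
  have hF2 : Finite (SL(2, residueFieldAt v)) := Subtype.finite
  exact ⟨PSL(2, residueFieldAt v), inferInstance, inferInstanceAs (Finite (_ ⧸ _)),
    (QuotientGroup.mk' _).comp (Matrix.SpecialLinearGroup.map (sIntegerReduction S v hv)), hord⟩
end

section
/- Let E be a number field, let Γ be a finitely generated subgroup of SL₂(E), and let m > 2 be an integer. Then the set of traces { trace(γ) : γ ∈ Γ and m is not a finitistic order for γ in Γ } is a finite subset of E. -/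
open scoped MatrixGroups

set_option linter.unusedSimpArgs false

noncomputable section PadePart

open Finset intervalIntegral Polynomial

lemma su_beta (b : ℕ) : ∀ a : ℕ, (∫ t in (0:ℝ)..1, t ^ a * (1 - t) ^ b) * ((a + b + 1).factorial : ℝ)
    = a.factorial * b.factorial := by
  induction b with
  | zero =>
    intro a
    simp only [pow_zero, mul_one, integral_pow, add_zero, Nat.factorial_succ]
    push_cast
    have : (a:ℝ) + 1 ≠ 0 := by positivity
    field_simp
    simp
  | succ b ih =>
    intro a
    have hd : ∀ t ∈ Set.uIcc (0:ℝ) 1, HasDerivAt (fun t : ℝ => t ^ (a+1) * (1 - t) ^ (b+1))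
        ((a+1) * (t ^ a * (1-t)^(b+1)) - (b+1) * (t^(a+1) * (1-t)^b)) t := by
      intro t _
      have h1 : HasDerivAt (fun t : ℝ => t ^ (a+1)) (((a+1:ℕ):ℝ) * t ^ a) t := by
        simpa using hasDerivAt_pow (a+1) t
      have h2 : HasDerivAt (fun t : ℝ => (1 - t) ^ (b+1)) (((b+1:ℕ):ℝ) * (1-t) ^ b * (-1)) t := by
        have := ((hasDerivAt_id t).const_sub 1).fun_pow (b+1)
        simpa using this
      convert! h1.mul h2 using 1
      push_cast; ring
    have hintg := integral_eq_sub_of_hasDerivAt hd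
      (Continuous.intervalIntegrable (by fun_prop) _ _)
    rw [integral_sub (Continuous.intervalIntegrable (by fun_prop) _ _)
      (Continuous.intervalIntegrable (by fun_prop) _ _), integral_const_mul, integral_const_mul] at hintg
    simp at hintg
    have h3 := ih (a+1)
    have e : a + 1 + b + 1 = a + (b+1) + 1 := by ring
    rw [e] at h3
    have ha : (a:ℝ) + 1 ≠ 0 := by positivity
    apply mul_left_cancel₀ ha
    rw [Nat.factorial_succ b, ← mul_assoc, sub_eq_zero.mp hintg, mul_assoc, h3, Nat.factorial_succ a]
    push_cast; ring

/-- Coefficients of the Padé polynomials. -/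
def suCoef (N k : ℕ) : ℤ := (-1) ^ k * ((3*N+1).choose (N-k) : ℤ) * ((N+k).choose k : ℤ)

/-- The homogeneous Padé form. -/
def suW {R : Type*} [CommRing R] (N : ℕ) (x y : R) : R :=
  ∑ k ∈ range (N+1), (suCoef N k : R) * x ^ k * y ^ (N-k)

lemma suW_map {R S : Type*} [CommRing R] [CommRing S] (f : R →+* S) (N : ℕ) (x y : R) :
    f (suW N x y) = suW N (f x) (f y) := by
  simp [suW]

/-- The normalizing factor. -/
def suD (N : ℕ) : ℝ := ((3*N+1).factorial : ℝ) / (N.factorial)^3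

lemma suW_integral (N : ℕ) (x y : ℝ) :
    suW N x y = suD N * ∫ t in (0:ℝ)..1, t ^ N * (1 - t) ^ N * (y - x * t) ^ N := by
  have h : ∀ t : ℝ, t ^ N * (1 - t) ^ N * (y - x * t) ^ N =
      ∑ k ∈ range (N+1), ((-x)^k * y^(N-k) * (N.choose k)) * (t ^ (N+k) * (1-t)^N) := by
    intro t
    rw [show y - x * t = (-x) * t + y by ring, add_pow, mul_sum]
    refine sum_congr rfl fun k _ => ?_
    rw [mul_pow, pow_add]; ring
  simp_rw [h]
  rw [integral_finsetSum fun k _ => Continuous.intervalIntegrable (by fun_prop) _ _, mul_sum, suW]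
  refine sum_congr rfl fun k hk => ?_
  rw [integral_const_mul]
  have hb := su_beta N (N+k)
  have hk' : k ≤ N := by simpa [Nat.lt_succ_iff] using hk
  have f1 : ((3*N+1).choose (N-k) : ℝ) = (3*N+1).factorial / ((N-k).factorial * (N+k+N+1).factorial) := by
    rw [Nat.cast_choose ℝ (by omega), show 3*N+1-(N-k) = N+k+N+1 by omega]
  have f2 : ((N+k).choose k : ℝ) = (N+k).factorial / (k.factorial * N.factorial) := by
    rw [Nat.cast_choose ℝ (by omega), show N+k-k = N by omega]
  have f3 : (N.choose k : ℝ) = N.factorial / (k.factorial * (N-k).factorial) :=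
    Nat.cast_choose ℝ hk'
  have hb' : (∫ t in (0:ℝ)..1, t ^ (N+k) * (1 - t) ^ N) =
     ((N+k).factorial * N.factorial) / ((N+k+N+1).factorial : ℝ) := by
    rw [eq_div_iff (by positivity)]; exact hb
  rw [hb', suCoef, suD]
  push_cast
  rw [f1, f2, f3, neg_pow x]
  field_simp

lemma suW_identity_real (N : ℕ) (x : ℝ) :
    x^(2*N+1) * suW N x 1 + (-1)^N * (1-x)^(2*N+1) * suW N (1-x) 1 = suW N 1 x := by
  have key : ∀ x : ℝ, x^(2*N+1) * suW N x 1 = suD N * ∫ s in (0:ℝ)..x, s^N * (1-s)^N * (x-s)^N := by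
    intro x
    rw [suW_integral, mul_left_comm]
    congr 1
    have h := intervalIntegral.smul_integral_comp_mul_left (a := 0) (b := 1)
      (fun s : ℝ => s^N * (1-s)^N * (x-s)^N) x
    simp only [mul_zero, mul_one, smul_eq_mul] at h
    rw [← h, show x^(2*N+1) = x * (x^N * x^N) by ring, mul_assoc, ← integral_const_mul]
    congr 1
    apply integral_congr
    intro t _
    simp only
    rw [show x - x * t = x * (1-t) by ring, mul_pow, mul_pow]; ring
  have h2 : (-1)^N * (∫ s in (0:ℝ)..(1-x), s^N * (1-s)^N * (1-x-s)^N)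
      = ∫ s in x..1, s^N * (1-s)^N * (x-s)^N := by
    have h := intervalIntegral.integral_comp_sub_left (a := x) (b := 1)
      (fun s : ℝ => s^N * (1-s)^N * (1-x-s)^N) 1
    simp only [sub_self] at h
    rw [← h, ← integral_const_mul]
    apply integral_congr
    intro t _
    simp only
    rw [show x - t = -1 * (t - x) by ring, show 1 - x - (1-t) = t - x by ring, mul_pow (-1:ℝ)]; ring
  rw [key x, mul_assoc, key (1-x), suW_integral, mul_left_comm, h2, ← mul_add,
    integral_add_adjacent_intervals (Continuous.intervalIntegrable (by fun_prop) _ _)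
      (Continuous.intervalIntegrable (by fun_prop) _ _)]
  simp

lemma suW_zero_pos (N : ℕ) : (0:ℝ) < suW N 0 1 := by
  rw [suW_integral]
  have := su_beta N N
  simp only [zero_mul, sub_zero, one_pow, mul_one]
  have h : 0 < (∫ t in (0:ℝ)..1, t ^ N * (1 - t) ^ N) := by
    by_contra hh
    have h1 : (0:ℝ) < N.factorial * N.factorial := by positivity
    rw [← this] at h1
    exact hh (pos_of_mul_pos_left h1 (by positivity))
  unfold suD
  positivity

lemma suW_one_pos (N : ℕ) : (0:ℝ) < suW N 1 1 := by
  rw [suW_integral]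
  have := su_beta (N+N) N
  have h : 0 < (∫ t in (0:ℝ)..1, t ^ N * (1 - t) ^ (N+N)) := by
    by_contra hh
    have h1 : (0:ℝ) < N.factorial * (N+N).factorial := by positivity
    rw [← this] at h1
    exact hh (pos_of_mul_pos_left h1 (by positivity))
  simp only [one_mul, mul_assoc, ← pow_add]
  unfold suD
  positivity

lemma suW_identity_poly (N : ℕ) :
    (X:ℤ[X])^(2*N+1) * suW N X 1 + (-1)^N * (1-X)^(2*N+1) * suW N (1-X) 1 = suW N 1 X := by
  apply Polynomial.map_injective (Int.castRingHom ℝ) Int.cast_injective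
  apply Polynomial.funext
  intro r
  have := suW_identity_real N r
  rw [← Polynomial.coe_mapRingHom]
  simp only [map_add, map_mul, map_pow, suW_map, map_sub, map_one, map_neg, Polynomial.coe_mapRingHom,
    Polynomial.map_X]
  simp only [← Polynomial.coe_evalRingHom, map_add, map_mul, map_pow, suW_map, map_sub, map_one, map_neg]
  simpa using this


/-- Bounded integer polynomials: degree at most `N`, sum of absolute values of coefficients
at most `B`. -/
def SuBd (N B : ℕ) (p : ℤ[X]) : Prop :=
  p.natDegree ≤ N ∧ ∑ k ∈ range (N+1), (p.coeff k).natAbs ≤ B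

lemma suA_eq (N : ℕ) : (suW N X 1 : ℤ[X]) = ∑ k ∈ range (N+1), C (suCoef N k) * X ^ k := by
  simp [suW]

lemma suC_eq (N : ℕ) : (suW N 1 X : ℤ[X]) = ∑ k ∈ range (N+1), C (suCoef N (N-k)) * X ^ k := by
  rw [← sum_range_reflect]
  simp only [suW]
  refine sum_congr rfl fun k hk => ?_
  have : k ≤ N := by simpa [Nat.lt_succ_iff] using hk
  simp [Nat.sub_sub_self this]

lemma suA_coeff (N k : ℕ) : (suW N X 1 : ℤ[X]).coeff k = if k ≤ N then suCoef N k else 0 := by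
  simp [suA_eq, coeff_C_mul, coeff_X_pow, Nat.lt_succ_iff]

lemma suC_coeff (N k : ℕ) : (suW N 1 X : ℤ[X]).coeff k = if k ≤ N then suCoef N (N-k) else 0 := by
  simp [suC_eq, coeff_C_mul, coeff_X_pow, Nat.lt_succ_iff]

lemma suCoef_natAbs (N k : ℕ) (hk : k ≤ N) : (suCoef N k).natAbs ≤ 2 ^ (5*N+1) := by
  simp only [suCoef, Int.natAbs_mul, Int.natAbs_pow, Int.natAbs_neg, Int.natAbs_one, one_pow, one_mul,
    Int.natAbs_natCast]
  calc _ ≤ 2^(3*N+1) * 2^(N+k) := Nat.mul_le_mul (Nat.choose_le_two_pow _ _) (Nat.choose_le_two_pow _ _)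
    _ ≤ 2^(3*N+1) * 2^(N+N) := by gcongr; norm_num
    _ = _ := by rw [← pow_add]; congr 1; ring

lemma SuBd_of_coeff (N : ℕ) (hN : 1 ≤ N) (p : ℤ[X]) (h0 : ∀ k, N < k → p.coeff k = 0)
    (h : ∀ k ≤ N, (p.coeff k).natAbs ≤ (3*N+1) * 2 ^ (5*N+1)) : SuBd N (512^N) p := by
  refine ⟨natDegree_le_iff_coeff_eq_zero.mpr h0, ?_⟩
  calc _ ≤ ∑ k ∈ range (N+1), (3*N+1) * 2 ^ (5*N+1) :=
        sum_le_sum fun k hk => h k (by simpa [Nat.lt_succ_iff] using hk)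
    _ = (N+1) * ((3*N+1) * 2 ^ (5*N+1)) := by simp
    _ ≤ 2^N * (2^(2*N) * 2^(5*N+1)) := by
        have h1 : N + 1 ≤ 2^N := Nat.lt_two_pow_self
        have h2 : 3*N+1 ≤ 2^(2*N) := by
          rw [pow_mul]
          have := one_add_mul_le_pow (R := ℤ) (a := 3) (by norm_num) N
          zify; norm_num at this ⊢; linarith
        gcongr
    _ = 2^(8*N+1) := by rw [← pow_add, ← pow_add]; congr 1; ring
    _ ≤ 2^(9*N) := by gcongr; norm_num; omega
    _ = 512^N := by rw [pow_mul]; norm_num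

lemma suPade (N : ℕ) (hN : 1 ≤ N) : ∃ A B C A₁ B₁ C₁ : ℤ[X],
    SuBd N (512^N) A ∧ SuBd N (512^N) B ∧ SuBd N (512^N) C ∧
    SuBd N (512^N) A₁ ∧ SuBd N (512^N) B₁ ∧ SuBd N (512^N) C₁ ∧
    ∀ (E : Type) [Field E] [CharZero E] (x y : E), x + y = 1 →
      x^(2*N+1) * aeval x A + y^(2*N+1) * aeval y B = aeval x C ∧
      x^(2*N) * aeval x A₁ + y^(2*N) * aeval y B₁ = aeval x C₁ ∧
      x * aeval x A * aeval y B₁ - y * aeval y B * aeval x A₁ ≠ 0 := by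
  set a : ℤ[X] := suW N X 1 with ha
  set c : ℤ[X] := suW N 1 X with hc
  set e : ℤ := (-1)^N with he
  set a₁ : ℤ[X] := ((2*N+1 : ℕ) : ℤ[X]) * a + X * derivative a with ha1
  have hca1 : ∀ k, a₁.coeff k = (2*N+1+k : ℕ) * a.coeff k := by
    intro k
    rw [ha1, coeff_add, coeff_natCast_mul]
    cases k with
    | zero => simp
    | succ k => rw [coeff_X_mul, coeff_derivative]; push_cast; ring
  have hee : e.natAbs = 1 := by simp [he, Int.natAbs_pow]
  have hacoef := suA_coeff N
  have hccoef := suC_coeff N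
  rw [← ha] at hacoef
  rw [← hc] at hccoef
  have ba : ∀ k, N < k → a.coeff k = 0 := fun k hk => by rw [hacoef, if_neg (by omega)]
  have bc : ∀ k, N < k → c.coeff k = 0 := fun k hk => by rw [hccoef, if_neg (by omega)]
  have ba' : ∀ k ≤ N, (a.coeff k).natAbs ≤ 2^(5*N+1) := fun k hk => by
    rw [hacoef, if_pos hk]; exact suCoef_natAbs N k hk
  have bc' : ∀ k, (c.coeff k).natAbs ≤ 2^(5*N+1) := fun k => by
    rw [hccoef]; split_ifs
    · exact suCoef_natAbs N _ (by omega)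
    · simp
  have hone : 2^(5*N+1) ≤ (3*N+1) * 2^(5*N+1) := Nat.le_mul_of_pos_left _ (by omega)
  have hmain : (X:ℤ[X])^(2*N+1) * a + (C e * (1-X)^(2*N+1)) * a.comp (1-X) = c := by
    have := suW_identity_poly N
    rw [← ha, ← hc] at this
    rw [← this]
    have hcomp : a.comp (1-X) = suW N (1-X) 1 := by
      rw [ha, ← coe_compRingHom_apply, suW_map]; simp
    rw [hcomp, he]; simp
  have hder : (X:ℤ[X])^(2*N) * a₁ + (C (-e) * (1-X)^(2*N)) * a₁.comp (1-X) = derivative c := by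
    rw [← hmain]
    simp only [derivative_add, derivative_mul, derivative_X_pow, derivative_pow, derivative_comp,
      derivative_sub, derivative_one, derivative_X, ha1, add_comp, mul_comp, X_comp, natCast_comp,
      derivative_C, Nat.add_sub_cancel, map_neg]
    push_cast
    simp only [C_add, C_mul, C_1, map_natCast, map_ofNat]
    ring
  set K : ℤ[X] := X * a * (C (-e) * a₁.comp (1-X)) - (1 - X) * (C e * a.comp (1-X)) * a₁ with hK
  have hKW : (X:ℤ[X])^(2*N) * (1-X)^(2*N) * K =
      (X^(2*N+1) * a) * derivative c - X^(2*N) * a₁ * c := by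
    rw [← hder, ← hmain, hK, map_neg]; ring
  have hadeg : a.natDegree ≤ N := natDegree_le_iff_coeff_eq_zero.mpr ba
  have hcdeg : c.natDegree ≤ N := natDegree_le_iff_coeff_eq_zero.mpr bc
  have ha1deg : a₁.natDegree ≤ N := natDegree_le_iff_coeff_eq_zero.mpr fun k hk => by
    rw [hca1, ba k hk, mul_zero]
  have hdeg : ((X^(2*N+1) * a) * derivative c - X^(2*N) * a₁ * c).natDegree ≤ 4*N := by
    apply (natDegree_sub_le _ _).trans
    have hcd : (derivative c).natDegree ≤ N - 1 := (natDegree_derivative_le c).trans (by omega)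
    have e1 : ((X:ℤ[X])^(2*N+1)).natDegree = 2*N+1 := natDegree_X_pow _
    have e2 : ((X:ℤ[X])^(2*N)).natDegree = 2*N := natDegree_X_pow _
    apply max_le
    · apply natDegree_mul_le.trans
      have := natDegree_mul_le (p := (X:ℤ[X])^(2*N+1)) (q := a)
      omega
    · apply natDegree_mul_le.trans
      have := natDegree_mul_le (p := (X:ℤ[X])^(2*N)) (q := a₁)
      omega
  have ha0 : a.eval 0 ≠ 0 := by
    have h := suW_zero_pos N
    intro h0
    have h2 : suW N 0 1 = a.eval 0 := by
      rw [ha, ← coe_evalRingHom, suW_map]; simp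
    rw [h0] at h2
    have h3 := suW_map (Int.castRingHom ℝ) N 0 1
    rw [h2] at h3
    simp at h3
    rw [← h3] at h; exact lt_irrefl _ h
  have ha1' : a.eval 1 ≠ 0 := by
    have h := suW_one_pos N
    intro h0
    have h2 : suW N 1 1 = a.eval 1 := by
      rw [ha, ← coe_evalRingHom, suW_map]; simp
    rw [h0] at h2
    have h3 := suW_map (Int.castRingHom ℝ) N 1 1
    rw [h2] at h3
    simp at h3
    rw [← h3] at h; exact lt_irrefl _ h
  have hK0 : K.eval 0 ≠ 0 := by
    have he0 : e ≠ 0 := by intro h; simp [h] at hee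
    have : K.eval 0 = - (e * a.eval 1 * ((2*N+1 : ℕ) * a.eval 0)) := by
      simp [hK, ha1]
    rw [this]
    have : ((2*N+1 : ℕ):ℤ) ≠ 0 := by positivity
    simp only [ne_eq, neg_eq_zero, mul_eq_zero, not_or]
    exact ⟨⟨he0, ha1'⟩, this, ha0⟩
  have hKne : K ≠ 0 := by rintro h; simp [h] at hK0
  have h1X : (1 - X : ℤ[X]).natDegree = 1 := by
    rw [← natDegree_neg, neg_sub, ← C_1, natDegree_X_sub_C]
  have h1Xne : (1 - X : ℤ[X]) ≠ 0 := by intro h; rw [h] at h1X; simp at h1X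
  have hKdeg : K.natDegree = 0 := by
    have h := hdeg
    rw [← hKW, natDegree_mul (mul_ne_zero (pow_ne_zero _ X_ne_zero) (pow_ne_zero _ h1Xne)) hKne,
      natDegree_mul (pow_ne_zero _ X_ne_zero) (pow_ne_zero _ h1Xne), natDegree_pow, natDegree_pow,
      natDegree_X, h1X] at h
    omega
  have hKC : K = C (K.eval 0) := by
    conv_lhs => rw [eq_C_of_natDegree_eq_zero hKdeg]
    rw [coeff_zero_eq_eval_zero]
  refine ⟨a, C e * a, c, a₁, C (-e) * a₁, derivative c, ?_, ?_, ?_, ?_, ?_, ?_, ?_⟩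
  · exact SuBd_of_coeff N hN _ ba fun k hk => (ba' k hk).trans hone
  · refine SuBd_of_coeff N hN _ (fun k hk => by rw [coeff_C_mul, ba k hk, mul_zero]) fun k hk => ?_
    rw [coeff_C_mul, Int.natAbs_mul, hee, one_mul]; exact (ba' k hk).trans hone
  · exact SuBd_of_coeff N hN _ bc fun k hk => (bc' k).trans hone
  · refine SuBd_of_coeff N hN _ (fun k hk => by rw [hca1, ba k hk, mul_zero]) fun k hk => ?_
    rw [hca1, Int.natAbs_mul, Int.natAbs_natCast]
    exact Nat.mul_le_mul (by omega) (ba' k hk)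
  · refine SuBd_of_coeff N hN _ (fun k hk => by rw [coeff_C_mul, hca1, ba k hk, mul_zero, mul_zero])
      fun k hk => ?_
    rw [coeff_C_mul, hca1, Int.natAbs_mul, Int.natAbs_mul, Int.natAbs_natCast, Int.natAbs_neg, hee, one_mul]
    exact Nat.mul_le_mul (by omega) (ba' k hk)
  · refine SuBd_of_coeff N hN _ (fun k hk => by rw [coeff_derivative, bc (k+1) (by omega), zero_mul])
      fun k hk => ?_
    rw [coeff_derivative, Int.natAbs_mul, mul_comm]
    refine Nat.mul_le_mul ?_ (bc' _)
    have : ((k:ℤ)+1).natAbs = k + 1 := by omega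
    omega
  · intro E _ _ x y hxy
    obtain rfl : y = 1 - x := by rw [← hxy]; ring
    have hcmp : ∀ p : ℤ[X], aeval x (p.comp (1-X)) = aeval (1-x) p := by
      intro p; rw [aeval_comp]; simp
    refine ⟨?_, ?_, ?_⟩
    · rw [← hmain]
      simp only [map_add, map_mul, map_pow, aeval_X, hcmp, aeval_C, map_sub, map_one]
      ring
    · rw [← hder]
      simp only [map_add, map_mul, map_pow, aeval_X, hcmp, aeval_C, map_sub, map_one]
      ring
    · have h := congrArg (aeval x) hKC
      rw [hK] at h
      simp only [map_add, map_mul, map_pow, aeval_X, hcmp, aeval_C, map_sub, map_one] at h ⊢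
      rw [← hK] at h
      rw [h]
      simpa using hK0

end PadePart

set_option linter.unusedSimpArgs false
section HeightPart

open Height AdmissibleAbsValues Function Multiset Polynomial

lemma su_hfms {K : Type*} [Field K] [AdmissibleAbsValues K] {ι : Type*} [Finite ι] {x : ι → K}
    (hx : x ≠ 0) :
    (fun v : nonarchAbsVal (K := K) ↦ ⨆ i, v.val (x i)).HasFiniteMulSupport := by
  have : Nonempty {j // x j ≠ 0} := nonempty_subtype.mpr <| ne_iff.mp hx
  suffices (fun v : nonarchAbsVal (K := K) ↦ ⨆ i : {j // x j ≠ 0}, v.val (x i)).HasFiniteMulSupport by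
    convert! this with v
    obtain ⟨i, hi⟩ : ∃ j, x j ≠ 0 := Function.ne_iff.mp hx
    have : Nonempty ι := .intro i
    refine le_antisymm (ciSup_le fun j ↦ ?_) (ciSup_le fun ⟨j, hj⟩ ↦ Finite.le_ciSup_of_le j le_rfl)
    rcases eq_or_ne (x j) 0 with h | h
    · rw [h, v.val.map_zero]
      exact Real.iSup_nonneg' ⟨⟨i, hi⟩, v.val.nonneg ..⟩
    · exact Finite.le_ciSup_of_le ⟨j, h⟩ le_rfl
  fun_prop (disch := grind)

lemma su_height_le {K : Type*} [Field K] [AdmissibleAbsValues K] {ι ι' κ : Type*} [Finite ι]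
    [Finite ι'] [Finite κ] {x : ι → K} {y : ι' → K} {z : κ → K} (hx : x ≠ 0) (hy : y ≠ 0)
    (hz : z ≠ 0) (c : ℝ) (N : ℕ) (hc : 0 ≤ c)
    (hA : ∀ v ∈ archAbsVal (K := K), ⨆ i, v (z i) ≤ c * ((⨆ i, v (x i)) * (⨆ i, v (y i)) ^ N))
    (hB : ∀ v ∈ nonarchAbsVal (K := K), ⨆ i, v (z i) ≤ (⨆ i, v (x i)) * (⨆ i, v (y i)) ^ N) :
    mulHeight z ≤ c ^ totalWeight K * (mulHeight x * mulHeight y ^ N) := by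
  rw [mulHeight_eq hx, mulHeight_eq hy, mulHeight_eq hz]
  have e1 : (archAbsVal.map fun v : AbsoluteValue K ℝ ↦ ⨆ i, v (z i)).prod ≤ c ^ totalWeight K *
      ((archAbsVal.map fun v : AbsoluteValue K ℝ ↦ ⨆ i, v (x i)).prod *
       (archAbsVal.map fun v : AbsoluteValue K ℝ ↦ ⨆ i, v (y i)).prod ^ N) := by
    have : c ^ totalWeight K = (archAbsVal.map fun v : AbsoluteValue K ℝ ↦ c).prod := by
      simp [totalWeight]
    rw [this, ← prod_map_pow, ← prod_map_mul, ← prod_map_mul]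
    exact prod_map_le_prod_map₀ _ _ (fun v _ ↦ Real.iSup_nonneg_of_nonnegHomClass ..) hA
  have e2 : (∏ᶠ v : nonarchAbsVal (K := K), ⨆ i, v.val (z i)) ≤
      (∏ᶠ v : nonarchAbsVal (K := K), ⨆ i, v.val (x i)) *
      (∏ᶠ v : nonarchAbsVal (K := K), ⨆ i, v.val (y i)) ^ N := by
    have F := su_hfms hy
    have F' := su_hfms hx
    have FN : (fun v : nonarchAbsVal (K := K) ↦ (⨆ i, v.val (y i)) ^ N).HasFiniteMulSupport :=
      F.pow N
    rw [finprod_pow F, ← finprod_mul_distrib F' FN]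
    exact finprod_le_finprod (su_hfms hz) (fun v ↦ Real.iSup_nonneg_of_nonnegHomClass ..)
      (F'.mul FN) fun v => hB v.1 v.2
  have H₂ : 0 ≤ (archAbsVal.map (fun v : AbsoluteValue K ℝ ↦ ⨆ i, v (x i))).prod :=
    prod_map_nonneg fun _ _ ↦ Real.iSup_nonneg_of_nonnegHomClass ..
  have H₃ : 0 ≤ (archAbsVal.map (fun v : AbsoluteValue K ℝ ↦ ⨆ i, v (y i))).prod :=
    prod_map_nonneg fun _ _ ↦ Real.iSup_nonneg_of_nonnegHomClass ..
  have H₄ : 0 ≤ ∏ᶠ v : nonarchAbsVal (K := K), ⨆ i, v.val (z i) :=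
    finprod_nonneg fun _ ↦ Real.iSup_nonneg_of_nonnegHomClass ..
  refine (mul_le_mul e1 e2 H₄ (by positivity)).trans (le_of_eq ?_)
  ring

lemma su_sup3 {K : Type*} [Field K] (v : AbsoluteValue K ℝ) (a b : K) {c : ℝ}
    (ha : v a ≤ c) (hb : v b ≤ c) (d : K) (hd : v d ≤ c) : ⨆ i, v (![a, b, d] i) ≤ c := by
  apply ciSup_le
  intro i
  fin_cases i <;> simpa

lemma su_le_sup {K : Type*} [Field K] (v : AbsoluteValue K ℝ) {n : ℕ} (x : Fin n → K) (i : Fin n) :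
    v (x i) ≤ ⨆ i, v (x i) := Finite.le_ciSup (fun i => v (x i)) i

lemma su_abv_int {K : Type*} [Field K] (v : AbsoluteValue K ℝ) (n : ℤ) : v (n : K) ≤ n.natAbs := by
  have h : ∀ n : ℕ, v (n : K) ≤ n := by
    intro n
    induction n with
    | zero => simp
    | succ n ih =>
      push_cast
      exact (v.add_le _ _).trans (by simpa using ih)
  rcases Int.natAbs_eq n with h' | h'
  · conv_lhs => rw [h']
    simpa using h n.natAbs
  · conv_lhs => rw [h']
    simpa using h n.natAbs

lemma su_poly_arch {K : Type*} [Field K] (v : AbsoluteValue K ℝ) {N B : ℕ} {p : ℤ[X]}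
    (hp : SuBd N B p) (x : K) {M : ℝ} (hM : 1 ≤ M) (hx : v x ≤ M) :
    v (aeval x p) ≤ B * M ^ N := by
  rw [aeval_eq_sum_range' (Nat.lt_succ_of_le hp.1)]
  calc _ ≤ ∑ k ∈ Finset.range (N+1), v (p.coeff k • x ^ k) := v.sum_le _ _
    _ ≤ ∑ k ∈ Finset.range (N+1), ((p.coeff k).natAbs : ℝ) * M ^ N := by
      refine Finset.sum_le_sum fun k hk => ?_
      have hk' : k ≤ N := by simpa [Nat.lt_succ_iff] using hk
      rw [zsmul_eq_mul, v.map_mul, map_pow]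
      refine mul_le_mul (su_abv_int v _) ?_ (pow_nonneg (v.nonneg _) _) (by positivity)
      exact (pow_le_pow_left₀ (v.nonneg _) hx k).trans (pow_le_pow_right₀ hM hk')
    _ ≤ _ := by
      rw [← Finset.sum_mul]
      gcongr
      exact_mod_cast hp.2

lemma su_poly_nonarch {K : Type*} [Field K] (v : AbsoluteValue K ℝ) (hv : IsNonarchimedean v)
    {N B : ℕ} {p : ℤ[X]}
    (hp : SuBd N B p) (x : K) {M : ℝ} (hM : 1 ≤ M) (hx : v x ≤ M) :
    v (aeval x p) ≤ M ^ N := by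
  rw [aeval_eq_sum_range' (Nat.lt_succ_of_le hp.1)]
  refine (hv.apply_sum_le).trans ?_
  have : Nonempty (Finset.range N.succ) := ⟨⟨0, by simp⟩⟩
  apply ciSup_le
  rintro ⟨k, hk⟩
  have hk' : k ≤ N := by simpa [Nat.lt_succ_iff] using hk
  rw [zsmul_eq_mul, v.map_mul, map_pow]
  calc _ ≤ 1 * M ^ k := mul_le_mul (hv.apply_intCast_le_one) (pow_le_pow_left₀ (v.nonneg _) hx k)
          (pow_nonneg (v.nonneg _) _) (by norm_num)
    _ ≤ _ := by rw [one_mul]; exact pow_le_pow_right₀ hM hk'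

lemma su_height_main {K : Type*} [Field K] [AdmissibleAbsValues K] {N B : ℕ} {P Q R : ℤ[X]}
    (hP : SuBd N B P) (hQ : SuBd N B Q) (hR : SuBd N B R) (x y p q : K) (L : ℕ)
    (h1 : x ^ L * aeval x P + y ^ L * aeval y Q = aeval x R) (h2 : x ^ L * p + y ^ L * q = 1)
    (hD : p * aeval y Q - q * aeval x P ≠ 0) :
    mulHeight ![x, y, 1] ^ L ≤
      (2 * B : ℝ) ^ totalWeight K * (mulHeight ![p, q, 1] * mulHeight ![x, y, 1] ^ N) := by
  set D := p * aeval y Q - q * aeval x P with hDdef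
  set z : Fin 3 → K := ![1 * aeval y Q - q * aeval x R, p * aeval x R - 1 * aeval x P, D] with hz
  have hz0 : z ≠ 0 := fun h => hD (by simpa [hz] using congrFun h 2)
  have hx0 : ![x, y, 1] ≠ 0 := fun h => by simpa using congrFun h 2
  have hp0 : ![p, q, 1] ≠ 0 := fun h => by simpa using congrFun h 2
  have hzz : z = D • (![x, y, 1] ^ L) := by
    ext i
    fin_cases i
    · simp [hz, hDdef]; linear_combination (-(aeval y Q)) * h2 + q * h1
    · simp [hz, hDdef]; linear_combination (aeval x P) * h2 - p * h1
    · simp [hz, hDdef]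
  have hh : mulHeight z = mulHeight ![x, y, 1] ^ L := by
    rw [hzz, mulHeight_smul_eq_mulHeight _ hD, mulHeight_pow]
  rw [← hh]
  have hone : ∀ v : AbsoluteValue K ℝ, ∀ u w : K, 1 ≤ ⨆ i, v (![u, w, 1] i) := fun v u w => by
    simpa using su_le_sup v ![u, w, 1] 2
  have hfst : ∀ v : AbsoluteValue K ℝ, ∀ u w : K, v u ≤ ⨆ i, v (![u, w, 1] i) := fun v u w => by
    simpa using su_le_sup v ![u, w, 1] 0
  have hsnd : ∀ v : AbsoluteValue K ℝ, ∀ u w : K, v w ≤ ⨆ i, v (![u, w, 1] i) := fun v u w => by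
    simpa using su_le_sup v ![u, w, 1] 1
  refine su_height_le hp0 hx0 hz0 _ N (by positivity) ?_ ?_
  · intro v hv
    set S := ⨆ i, v (![p, q, 1] i)
    set T := ⨆ i, v (![x, y, 1] i)
    have hS := hone v p q
    have hT := hone v x y
    have b1 := su_poly_arch v hP x hT (hfst v x y)
    have b2 := su_poly_arch v hQ y hT (hsnd v x y)
    have b3 := su_poly_arch v hR x hT (hfst v x y)
    have key : ∀ a b c d : K, v a ≤ S → v c ≤ S → v b ≤ B * T^N → v d ≤ B * T^N →
        v (a * b - c * d) ≤ 2 * B * (S * T^N) := by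
      intro a b c d ha hc hb hd
      have t1 : v (a * b) ≤ S * (B * T^N) := by
        rw [v.map_mul]; exact mul_le_mul ha hb (v.nonneg _) (by linarith)
      have t2 : v (c * d) ≤ S * (B * T^N) := by
        rw [v.map_mul]; exact mul_le_mul hc hd (v.nonneg _) (by linarith)
      have : v (a * b - c * d) ≤ v (a*b) + v (c*d) := by
        have := v.add_le (a*b) (-(c*d))
        rwa [v.map_neg, ← sub_eq_add_neg] at this
      linarith
    have v1 : v 1 ≤ S := by simpa using hS
    exact su_sup3 v _ _ (key _ _ _ _ v1 (hsnd v p q) b2 b3) (key _ _ _ _ (hfst v p q) v1 b3 b1) _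
      (key _ _ _ _ (hfst v p q) (hsnd v p q) b2 b1)
  · intro v hv
    have hna := isNonarchimedean v hv
    set S := ⨆ i, v (![p, q, 1] i)
    set T := ⨆ i, v (![x, y, 1] i)
    have hS := hone v p q
    have hT := hone v x y
    have b1 := su_poly_nonarch v hna hP x hT (hfst v x y)
    have b2 := su_poly_nonarch v hna hQ y hT (hsnd v x y)
    have b3 := su_poly_nonarch v hna hR x hT (hfst v x y)
    have key : ∀ a b c d : K, v a ≤ S → v c ≤ S → v b ≤ T^N → v d ≤ T^N →
        v (a * b - c * d) ≤ S * T^N := by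
      intro a b c d ha hc hb hd
      have t1 : v (a * b) ≤ S * (T^N) := by
        rw [v.map_mul]; exact mul_le_mul ha hb (v.nonneg _) (by linarith)
      have t2 : v (c * d) ≤ S * (T^N) := by
        rw [v.map_mul]; exact mul_le_mul hc hd (v.nonneg _) (by linarith)
      have : v (a * b - c * d) ≤ max (v (a*b)) (v (c*d)) := by
        have := hna (a*b) (-(c*d))
        rwa [v.map_neg, ← sub_eq_add_neg] at this
      exact this.trans (max_le t1 t2)
    have v1 : v 1 ≤ S := by simpa using hS
    exact su_sup3 v _ _ (key _ _ _ _ v1 (hsnd v p q) b2 b3) (key _ _ _ _ (hfst v p q) v1 b3 b1) _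
      (key _ _ _ _ (hfst v p q) (hsnd v p q) b2 b1)

/-- Passing to logarithms. -/
lemma su_log_main {K : Type*} [Field K] [AdmissibleAbsValues K] {N B : ℕ} (hB : 1 ≤ B) {P Q R : ℤ[X]}
    (hP : SuBd N B P) (hQ : SuBd N B Q) (hR : SuBd N B R) (x y p q : K) (L : ℕ)
    (h1 : x ^ L * aeval x P + y ^ L * aeval y Q = aeval x R) (h2 : x ^ L * p + y ^ L * q = 1)
    (hD : p * aeval y Q - q * aeval x P ≠ 0) :
    L * logHeight ![x, y, 1] ≤ totalWeight K * Real.log (2 * B) + logHeight ![p, q, 1] +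
      N * logHeight ![x, y, 1] := by
  have h := su_height_main hP hQ hR x y p q L h1 h2 hD
  have p1 := mulHeight_pos ![x, y, 1]
  have p2 := mulHeight_pos ![p, q, 1]
  have hB' : (0:ℝ) < 2 * B := by positivity
  have h' := Real.log_le_log (by positivity) h
  rw [Real.log_mul (by positivity) (by positivity), Real.log_mul (by positivity) (by positivity),
    Real.log_pow, Real.log_pow, Real.log_pow] at h'
  simp only [logHeight_eq_log_mulHeight]
  linarith

/-- Key gap inequality. -/
lemma su_gap {K : Type} [Field K] [CharZero K] [AdmissibleAbsValues K] (x y x' y' : K) (hx : x ≠ 0)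
    (hy : y ≠ 0) (h : x + y = 1) (h' : x' + y' = 1) (N : ℕ) (hN : 1 ≤ N) :
    ∃ L : ℕ, (L = 2*N ∨ L = 2*N+1) ∧ N * logHeight ![x, y, 1] ≤
      logHeight ![x' / x^L, y' / y^L, 1] + (totalWeight K * Real.log 1024) * N := by
  obtain ⟨A, B, C, A₁, B₁, C₁, hA, hB, hC, hA₁, hB₁, hC₁, H⟩ := suPade N hN
  obtain ⟨H1, H2, H3⟩ := H K x y h
  have h512 : 1 ≤ 512^N := Nat.one_le_pow _ _ (by norm_num)
  have hlog : (totalWeight K : ℝ) * Real.log (2 * ((512^N : ℕ):ℝ)) ≤ totalWeight K * Real.log 1024 * N := by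
    rw [mul_assoc]
    gcongr
    rw [mul_comm (Real.log 1024), ← Real.log_pow]
    apply Real.log_le_log (by positivity)
    push_cast
    calc (2:ℝ) * 512^N ≤ 2^N * 512^N := by
          gcongr
          calc (2:ℝ) = 2^1 := by norm_num
            _ ≤ 2^N := by gcongr; norm_num
      _ = 1024^N := by rw [← mul_pow]; norm_num
  have hh := logHeight_nonneg ![x, y, 1]
  have hpq : ∀ L : ℕ, x^L * (x'/x^L) + y^L * (y'/y^L) = 1 := by
    intro L
    rw [mul_div_cancel₀ _ (pow_ne_zero _ hx), mul_div_cancel₀ _ (pow_ne_zero _ hy), h']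
  by_cases hD : x' / x^(2*N+1) * aeval y B - y' / y^(2*N+1) * aeval x A = 0
  · have hD2 : x' / x^(2*N) * aeval y B₁ - y' / y^(2*N) * aeval x A₁ ≠ 0 := by
      intro hD2
      have e1 : x' / x^(2*N) = x * (x' / x^(2*N+1)) := by field_simp; ring
      have e2 : y' / y^(2*N) = y * (y' / y^(2*N+1)) := by field_simp; ring
      rw [e1, e2] at hD2
      have hs := hpq (2*N+1)
      set p := x' / x^(2*N+1)
      set q := y' / y^(2*N+1)
      by_cases hp : p = 0
      · have hq : q ≠ 0 := by rintro hq; simp [hp, hq] at hs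
        have hA0 : aeval x A = 0 := by simpa [hp, hq] using hD
        have hA1 : aeval x A₁ = 0 := by simpa [hp, hq, hy] using hD2
        exact H3 (by rw [hA0, hA1]; ring)
      · apply H3
        have : p * (x * aeval x A * aeval y B₁ - y * aeval y B * aeval x A₁) = 0 := by
          linear_combination (aeval x A) * hD2 - y * (aeval x A₁) * hD
        exact (mul_eq_zero.mp this).resolve_left hp
    refine ⟨2*N, Or.inl rfl, ?_⟩
    have := su_log_main h512 hA₁ hB₁ hC₁ x y _ _ (2*N) H2 (hpq _) hD2
    push_cast at this hlog ⊢
    linarith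
  · refine ⟨2*N+1, Or.inr rfl, ?_⟩
    have := su_log_main h512 hA hB hC x y _ _ (2*N+1) H1 (hpq _) hD
    push_cast at this hlog ⊢
    linarith

end HeightPart

set_option linter.unusedSimpArgs false
section ConePart

open Filter Topology

lemma su_cone {α ι : Type*} [Fintype ι] (T : Set α) (ℓ : α → ι → ℝ) (h : α → ℝ)
    (hN : ∀ B : ℝ, {a | a ∈ T ∧ h a ≤ B}.Finite) (hle : ∀ a ∈ T, ‖ℓ a‖ ≤ h a) (Kc c : ℝ) (hK : 0 < Kc)
    (gap : ∀ P ∈ T, ∀ Q ∈ T, ∀ N : ℕ, 1 ≤ N → ∃ L : ℕ, (L = 2*N ∨ L = 2*N+1) ∧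
      N * h P ≤ Kc * ‖ℓ Q - (L:ℝ) • ℓ P‖ + c * N) : T.Finite := by
  by_contra hT
  have hT : T.Infinite := hT
  let a : ℕ → α := fun n => (hT.natEmbedding T n : α)
  have haT : ∀ n, a n ∈ T := fun n => (hT.natEmbedding T n).2
  have hainj : Function.Injective a := fun i j hij => (hT.natEmbedding T).injective (Subtype.ext hij)
  have hlim : Tendsto (fun n => h (a n)) atTop atTop := by
    rw [tendsto_atTop]
    intro B
    have : {n | ¬ B ≤ h (a n)}.Finite := by
      refine Set.Finite.subset ((hN B).preimage hainj.injOn) ?_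
      intro n hn
      exact ⟨haT n, le_of_lt (not_le.mp hn)⟩
    rw [← Nat.cofinite_eq_atTop]
    exact this
  let u : ℕ → ι → ℝ := fun n => (h (a n))⁻¹ • ℓ (a n)
  have hu : ∀ n, u n ∈ Metric.closedBall (0 : ι → ℝ) 1 := by
    intro n
    have h1 := hle _ (haT n)
    have h2 := norm_nonneg (ℓ (a n))
    rw [mem_closedBall_zero_iff, norm_smul, norm_inv, Real.norm_of_nonneg (h2.trans h1)]
    exact inv_mul_le_one_of_le₀ h1 (h2.trans h1)
  obtain ⟨e, he, φ, hφ, hconv⟩ := (isCompact_closedBall (0 : ι → ℝ) 1).tendsto_subseq hu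
  have he1 : ‖e‖ ≤ 1 := by simpa using he
  set ε : ℝ := 1 / (28 * Kc) with hε
  have hεpos : 0 < ε := by positivity
  have hlim' : Tendsto (fun n => h (a (φ n))) atTop atTop := hlim.comp hφ.tendsto_atTop
  have hev : ∀ᶠ n in atTop, ‖u (φ n) - e‖ < ε := by
    have := (Metric.tendsto_nhds.mp hconv) ε hεpos
    filter_upwards [this] with n hn
    rwa [dist_eq_norm] at hn
  obtain ⟨n1, hn1, hn1'⟩ := (hev.and (hlim'.eventually_ge_atTop (max (4*c) 1))).exists
  set P := a (φ n1) with hP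
  have hP1 : 1 ≤ h P := (le_max_right _ _).trans hn1'
  have hPc : 4 * c ≤ h P := (le_max_left _ _).trans hn1'
  obtain ⟨N0, hN0⟩ := exists_nat_ge (8 * Kc)
  obtain ⟨n2, hn2, hn2'⟩ := (hev.and (hlim'.eventually_ge_atTop (2 * (N0+1) * h P))).exists
  set Q := a (φ n2) with hQ
  have hPpos : 0 < h P := by linarith
  have hQpos : 0 < h Q := lt_of_lt_of_le (by positivity) hn2'
  set N := ⌊h Q / (2 * h P)⌋₊ with hNdef
  have hNlow : (N0 + 1 : ℝ) ≤ h Q / (2 * h P) := by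
    rw [le_div_iff₀ (by positivity)]; linarith
  have hNN0 : N0 + 1 ≤ N := by
    apply Nat.le_floor; exact_mod_cast hNlow
  have hN1 : 1 ≤ N := by omega
  have f1 : (N:ℝ) * (2 * h P) ≤ h Q := by
    rw [← le_div_iff₀ (by positivity)]; exact Nat.floor_le (by positivity)
  have f2 : h Q < (N + 1) * (2 * h P) := by
    rw [← div_lt_iff₀ (by positivity)]; exact Nat.lt_floor_add_one _
  have hNr : (1:ℝ) ≤ N := by exact_mod_cast hN1
  have hNK : 8 * Kc ≤ N := hN0.trans (by exact_mod_cast (by omega : N0 ≤ N))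
  obtain ⟨L, hL, hg⟩ := gap P (haT _) Q (haT _) N hN1
  have hL1 : (2 * N : ℝ) ≤ L := by rcases hL with rfl | rfl <;> push_cast <;> linarith
  have hL2 : (L : ℝ) ≤ 2 * N + 1 := by rcases hL with rfl | rfl <;> push_cast <;> linarith
  have eP : ℓ P = h P • u (φ n1) := by
    simp only [u]; rw [smul_smul, mul_inv_cancel₀ hPpos.ne', one_smul]
  have eQ : ℓ Q = h Q • u (φ n2) := by
    simp only [u]; rw [smul_smul, mul_inv_cancel₀ hQpos.ne', one_smul]
  have dec : ℓ Q - (L:ℝ) • ℓ P = h Q • (u (φ n2) - e) - (L * h P) • (u (φ n1) - e)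
      + (h Q - L * h P) • e := by
    rw [eP, eQ]; module
  have habs : |h Q - L * h P| ≤ 2 * h P := by
    rw [abs_le]; constructor <;> nlinarith
  have hnorm : ‖ℓ Q - (L:ℝ) • ℓ P‖ ≤ h Q * ε + L * h P * ε + 2 * h P := by
    rw [dec]
    refine (norm_add_le _ _).trans (add_le_add ((norm_sub_le _ _).trans (add_le_add ?_ ?_)) ?_)
    · rw [norm_smul, Real.norm_of_nonneg hQpos.le]; gcongr
    · rw [norm_smul, Real.norm_of_nonneg (by positivity)]; gcongr
    · rw [norm_smul, Real.norm_eq_abs]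
      calc _ ≤ 2 * h P * 1 := by gcongr
        _ = _ := by ring
  have hnorm2 : ‖ℓ Q - (L:ℝ) • ℓ P‖ ≤ 7 * (N * h P) * ε + 2 * h P := by
    refine hnorm.trans ?_
    have : h Q + L * h P ≤ 7 * (N * h P) := by nlinarith
    nlinarith
  have hKe : Kc * ε = 1 / 28 := by rw [hε]; field_simp
  have : Kc * ‖ℓ Q - (L:ℝ) • ℓ P‖ ≤ (N * h P) / 4 + 2 * Kc * h P := by
    calc _ ≤ Kc * (7 * (N * h P) * ε + 2 * h P) := by gcongr
      _ = 7 * (N * h P) * (Kc * ε) + 2 * Kc * h P := by ring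
      _ = _ := by rw [hKe]; ring
  have t1 : 2 * Kc * h P ≤ N * h P / 4 := by nlinarith
  have t2 : c * N ≤ N * h P / 4 := by nlinarith
  have : 0 < N * h P := by positivity
  linarith

end ConePart

section SUnitPart
open Height NumberField

noncomputable def suAv {K : Type} [Field K] [NumberField K] (S : Finset (FinitePlace K)) :
    InfinitePlace K ⊕ S → K → ℝ
  | Sum.inl v, x => v x
  | Sum.inr v, x => v.1 x

noncomputable def suWt {K : Type} [Field K] [NumberField K] (S : Finset (FinitePlace K)) :
    InfinitePlace K ⊕ S → ℝ
  | Sum.inl v => v.mult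
  | Sum.inr _ => 1

def SuUnit {K : Type} [Field K] [NumberField K] (S : Finset (FinitePlace K)) (x : K) : Prop :=
  x ≠ 0 ∧ ∀ v : FinitePlace K, v ∉ S → v x = 1

variable {K : Type} [Field K] [NumberField K] (S : Finset (FinitePlace K))

lemma suAv_pos (i : InfinitePlace K ⊕ S) {x : K} (hx : x ≠ 0) : 0 < suAv S i x := by
  rcases i with v | v
  · exact InfinitePlace.pos_iff.mpr hx
  · exact FinitePlace.pos_iff.mpr hx

lemma suAv_div (i : InfinitePlace K ⊕ S) (x y : K) : suAv S i (x / y) = suAv S i x / suAv S i y := by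
  rcases i with v | v <;> simp [suAv]

lemma suAv_inv (i : InfinitePlace K ⊕ S) (x : K) : suAv S i (x⁻¹) = (suAv S i x)⁻¹ := by
  rcases i with v | v <;> simp [suAv]

lemma suAv_pow (i : InfinitePlace K ⊕ S) (x : K) (n : ℕ) : suAv S i (x ^ n) = suAv S i x ^ n := by
  rcases i with v | v <;> simp [suAv]

lemma suWt_one_le (i : InfinitePlace K ⊕ S) : 1 ≤ suWt S i := by
  rcases i with v | v
  · simp only [suWt]; exact_mod_cast InfinitePlace.mult_pos
  · simp [suWt]

lemma SuUnit.inv {x : K} (hx : SuUnit S x) : SuUnit S x⁻¹ :=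
  ⟨inv_ne_zero hx.1, fun v hv => by rw [map_inv₀, hx.2 v hv, inv_one]⟩

lemma SuUnit.div_pow {x y : K} (hx : SuUnit S x) (hy : SuUnit S y) (n : ℕ) : SuUnit S (x / y ^ n) :=
  ⟨div_ne_zero hx.1 (pow_ne_zero _ hy.1), fun v hv => by
    rw [map_div₀, map_pow, hx.2 v hv, hy.2 v hv]; simp⟩

lemma su_logHeight₁ {x : K} (hx : SuUnit S x) :
    logHeight₁ x = ∑ i, suWt S i * Real.posLog (suAv S i x) := by
  classical
  rw [NumberField.logHeight₁_eq, Fintype.sum_sum_type]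
  congr 1
  rw [finsum_eq_sum_of_support_subset (s := S)]
  · rw [← Finset.sum_coe_sort S]
    simp [suWt, suAv]
  · intro v hv
    by_contra hvS
    apply hv
    simp [hx.2 v hvS]

lemma su_log_le {x : K} (hx : SuUnit S x) (i : InfinitePlace K ⊕ S) :
    Real.log (suAv S i x) ≤ logHeight₁ x := by
  rw [su_logHeight₁ S hx]
  have h0 : ∀ j, 0 ≤ suWt S j * Real.posLog (suAv S j x) := fun j =>
    mul_nonneg (by linarith [suWt_one_le S j]) Real.posLog_nonneg
  refine le_trans ?_ (Finset.single_le_sum (fun j _ => h0 j) (Finset.mem_univ i))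
  have h1 : Real.log (suAv S i x) ≤ Real.posLog (suAv S i x) := le_max_right _ _
  nlinarith [suWt_one_le S i, Real.posLog_nonneg (x := suAv S i x)]

lemma su_abs_log_le {x : K} (hx : SuUnit S x) (i : InfinitePlace K ⊕ S) :
    |Real.log (suAv S i x)| ≤ logHeight₁ x := by
  rw [abs_le]
  refine ⟨?_, su_log_le S hx i⟩
  have := su_log_le S (hx.inv S) i
  rw [suAv_inv, Real.log_inv, logHeight₁_inv] at this
  linarith

lemma su_logHeight₁_le {x : K} (hx : SuUnit S x) {B : ℝ} (hB : 0 ≤ B)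
    (h : ∀ i, Real.log (suAv S i x) ≤ B) : logHeight₁ x ≤ (∑ i, suWt S i) * B := by
  rw [su_logHeight₁ S hx, Finset.sum_mul]
  refine Finset.sum_le_sum fun i _ => ?_
  have := suWt_one_le S i
  gcongr
  exact max_le hB (h i)

lemma su_height3 (p q : K) : logHeight ![p, q, 1] ≤ logHeight₁ p + logHeight₁ q := by
  have hx0 : ![p, 1] ≠ 0 := fun h => by simpa using congrFun h 1
  have hy0 : ![q, 1] ≠ 0 := fun h => by simpa using congrFun h 1
  have hz0 : ![p, q, 1] ≠ 0 := fun h => by simpa using congrFun h 2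
  have key : ∀ v : AbsoluteValue K ℝ, ⨆ i, v (![p, q, 1] i) ≤ (⨆ i, v (![p, 1] i)) *
      (⨆ i, v (![q, 1] i)) ^ 1 := by
    intro v
    have a1 : v p ≤ ⨆ i, v (![p, 1] i) := by simpa using su_le_sup v ![p, 1] 0
    have a2 : 1 ≤ ⨆ i, v (![p, 1] i) := by simpa using su_le_sup v ![p, 1] 1
    have b1 : v q ≤ ⨆ i, v (![q, 1] i) := by simpa using su_le_sup v ![q, 1] 0
    have b2 : 1 ≤ ⨆ i, v (![q, 1] i) := by simpa using su_le_sup v ![q, 1] 1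
    rw [pow_one]
    refine su_sup3 v _ _ ?_ ?_ _ ?_
    · nlinarith [v.nonneg p]
    · nlinarith [v.nonneg q]
    · rw [v.map_one]; nlinarith
  have := su_height_le hx0 hy0 hz0 1 1 zero_le_one (fun v _ => by rw [one_mul]; exact key v)
    (fun v _ => key v)
  rw [one_pow, one_mul, pow_one] at this
  rw [logHeight₁_eq_logHeight, logHeight₁_eq_logHeight]
  simp only [logHeight_eq_log_mulHeight]
  rw [← Real.log_mul (mulHeight_pos _).ne' (mulHeight_pos _).ne']
  exact Real.log_le_log (mulHeight_pos _) this

/-- The `S`-unit theorem in two variables. -/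
theorem su_sunit : {x : K | SuUnit S x ∧ SuUnit S (1 - x)}.Finite := by
  classical
  let ℓ : K → (InfinitePlace K ⊕ S) × Bool → ℝ := fun x i =>
    if i.2 then Real.log (suAv S i.1 x) else Real.log (suAv S i.1 (1 - x))
  let W : ℝ := ∑ i, suWt S i
  have hW : 0 ≤ W := Finset.sum_nonneg fun i _ => by linarith [suWt_one_le S i]
  have hx1 : ∀ x : K, logHeight₁ x ≤ logHeight ![x, 1 - x, 1] := by
    intro x
    rw [logHeight₁_eq_logHeight]
    have := logHeight_comp_le ![(0 : Fin 3), 2] ![x, 1 - x, 1]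
    convert this using 2
    ext i; fin_cases i <;> simp
  have hx2 : ∀ x : K, logHeight₁ (1 - x) ≤ logHeight ![x, 1 - x, 1] := by
    intro x
    rw [logHeight₁_eq_logHeight]
    have := logHeight_comp_le ![(1 : Fin 3), 2] ![x, 1 - x, 1]
    convert this using 2
    ext i; fin_cases i <;> simp
  refine su_cone (ι := (InfinitePlace K ⊕ S) × Bool) _ ℓ (fun x => logHeight ![x, 1 - x, 1]) ?_ ?_
    (2 * W + 1) (totalWeight K * Real.log 1024) (by positivity) ?_
  · intro B
    refine (Northcott.finite_le (h := logHeight₁ (K := K)) B).subset ?_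
    rintro x ⟨_, hx⟩
    exact (hx1 x).trans hx
  · rintro x ⟨hx, hy⟩
    rw [pi_norm_le_iff_of_nonneg (logHeight_nonneg _)]
    rintro ⟨i, b⟩
    rw [Real.norm_eq_abs]
    rcases b with _ | _
    · exact (su_abs_log_le S hy i).trans (hx2 x)
    · exact (su_abs_log_le S hx i).trans (hx1 x)
  · rintro x ⟨hx, hy⟩ x' ⟨hx', hy'⟩ N hN
    obtain ⟨L, hL, hg⟩ := su_gap x (1 - x) x' (1 - x') hx.1 hy.1 (by ring) (by ring) N hN
    refine ⟨L, hL, hg.trans ?_⟩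
    gcongr
    refine (su_height3 _ _).trans ?_
    set M := ‖ℓ x' - (L : ℝ) • ℓ x‖ with hM
    have hM0 : 0 ≤ M := norm_nonneg _
    have hbd : ∀ i, (ℓ x' - (L : ℝ) • ℓ x) i ≤ M := fun i =>
      (Real.le_norm_self _).trans (norm_le_pi_norm (ℓ x' - (L : ℝ) • ℓ x) i)
    have hlog : ∀ i (a b : K), a ≠ 0 → b ≠ 0 → Real.log (suAv S i (a / b ^ L)) =
        Real.log (suAv S i a) - L * Real.log (suAv S i b) := by
      intro i a b ha hb
      rw [suAv_div, suAv_pow, Real.log_div (suAv_pos S i ha).ne'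
        (pow_ne_zero _ (suAv_pos S i hb).ne'), Real.log_pow]
    have k1 := su_logHeight₁_le S (hx'.div_pow S hx L) hM0 (fun i => by
      rw [hlog i _ _ hx'.1 hx.1]
      simpa [ℓ] using hbd (i, true))
    have k2 := su_logHeight₁_le S (hy'.div_pow S hy L) hM0 (fun i => by
      rw [hlog i _ _ hy'.1 hy.1]
      simpa [ℓ] using hbd (i, false))
    change _ ≤ W * M at k1
    change _ ≤ W * M at k2
    linarith

end SUnitPart

section GroupPart
open NumberField IsDedekindDomain Polynomial

lemma su_pow_formula {k : Type*} [Field k] (A : Matrix (Fin 2) (Fin 2) k) (hdet : A.det = 1) (ξ : k)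
    (hξ : ξ ≠ 0) (ht : A.trace = ξ + ξ⁻¹) (n : ℕ) :
    (ξ - ξ⁻¹) • A ^ n = (ξ ^ n - ξ⁻¹ ^ n) • A - (ξ ^ n * ξ⁻¹ - ξ⁻¹ ^ n * ξ) • (1 : Matrix (Fin 2) (Fin 2) k) := by
  have hsq : A * A = (ξ + ξ⁻¹) • A - (1 : Matrix (Fin 2) (Fin 2) k) := by
    rw [← ht]
    rw [Matrix.det_fin_two] at hdet
    rw [Matrix.trace_fin_two]
    ext i j
    fin_cases i <;> fin_cases j <;> simp [Matrix.mul_apply, Fin.sum_univ_two] <;>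
      first | linear_combination (-1 : k) * hdet | ring1
  have hi : ξ * ξ⁻¹ = 1 := mul_inv_cancel₀ hξ
  induction n with
  | zero =>
    simp only [pow_zero, sub_self, zero_smul, one_mul, zero_sub, ← neg_smul, neg_sub]
  | succ n ih =>
    rw [pow_succ, ← smul_mul_assoc, ih, sub_mul, smul_mul_assoc, smul_mul_assoc, one_mul, hsq,
      smul_sub, smul_smul]
    rw [pow_succ, pow_succ]
    ext i j
    simp only [Matrix.sub_apply, Matrix.smul_apply, smul_eq_mul]
    linear_combination (A i j * 0 - (ξ^n - ξ⁻¹^n) * (0 * (1 : Matrix (Fin 2) (Fin 2) k) i j) + (ξ^n - ξ⁻¹^n) * (1 : Matrix (Fin 2) (Fin 2) k) i j) * hi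

lemma su_order {k : Type*} [Field k] (A : SL(2, k)) (ξ : k) (hξ : ξ ≠ 0) (hξ2 : ξ ^ 2 ≠ 1)
    (ht : (A : Matrix (Fin 2) (Fin 2) k).trace = ξ + ξ⁻¹) :
    orderOf (QuotientGroup.mk' (Subgroup.center SL(2, k)) A) = orderOf (ξ ^ 2) := by
  have hi : ξ * ξ⁻¹ = 1 := mul_inv_cancel₀ hξ
  have hd : ξ - ξ⁻¹ ≠ 0 := by
    intro h
    apply hξ2
    linear_combination ξ * h + hi
  rw [orderOf_eq_orderOf_iff]
  intro n
  rw [← map_pow, QuotientGroup.mk'_apply, QuotientGroup.eq_one_iff,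
    Matrix.SpecialLinearGroup.mem_center_iff]
  have hf := su_pow_formula (A : Matrix (Fin 2) (Fin 2) k) A.2 ξ hξ ht n
  have hdet := A.2
  rw [Matrix.det_fin_two] at hdet
  rw [Matrix.trace_fin_two] at ht
  have hXY : ξ^n * ξ⁻¹^n = 1 := by rw [← mul_pow, hi, one_pow]
  constructor
  · rintro ⟨r, -, hr⟩
    rw [Matrix.SpecialLinearGroup.coe_pow] at hr
    rw [← hr] at hf
    by_contra hne
    have hX : ξ^n - ξ⁻¹^n ≠ 0 := by
      intro h
      apply hne
      rw [← pow_mul, mul_comm, pow_mul]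
      linear_combination ξ^n * h + hXY
    have h01 := congrFun (congrFun hf 0) 1
    have h10 := congrFun (congrFun hf 1) 0
    have h00 := congrFun (congrFun hf 0) 0
    have h11 := congrFun (congrFun hf 1) 1
    simp at h01 h10
    simp at h00 h11
    have h01' : (A : Matrix (Fin 2) (Fin 2) k) 0 1 = 0 := by
      rcases h01 with h | h
      · exact absurd (by linear_combination h) hX
      · exact h
    have he : (A : Matrix (Fin 2) (Fin 2) k) 0 0 = (A : Matrix (Fin 2) (Fin 2) k) 1 1 := by
      apply mul_left_cancel₀ hX
      simp only [inv_pow]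
      linear_combination h11 - h00
    rw [h01', he] at hdet
    rw [he] at ht
    have : (ξ - ξ⁻¹)^2 = 0 := by
      linear_combination 4 * hdet - (2 * (A : Matrix (Fin 2) (Fin 2) k) 1 1 + ξ + ξ⁻¹) * ht - 4 * hi
    exact hd (pow_eq_zero_iff (two_ne_zero) |>.mp this)
  · intro h
    have hX : ξ^n = ξ⁻¹^n := by
      rw [← pow_mul, mul_comm, pow_mul] at h
      have : ξ^n ≠ 0 := pow_ne_zero _ hξ
      apply mul_left_cancel₀ this
      rw [hXY, ← h]; ring
    rw [← hX, sub_self, zero_smul, zero_sub, ← neg_smul] at hf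
    have hA : (A : Matrix (Fin 2) (Fin 2) k) ^ n = ξ^n • (1 : Matrix (Fin 2) (Fin 2) k) := by
      have h2 : -(ξ ^ n * ξ⁻¹ - ξ ^ n * ξ) = (ξ - ξ⁻¹) * ξ^n := by ring
      rw [h2, mul_smul] at hf
      exact smul_right_injective _ hd hf
    refine ⟨ξ^n, ?_, ?_⟩
    · rw [Fintype.card_fin, ← pow_mul, mul_comm, pow_mul]; exact h
    · rw [Matrix.SpecialLinearGroup.coe_pow, hA, Matrix.smul_one_eq_diagonal, Matrix.scalar_apply]

lemma su_residue {K : Type} [Field K] [NumberField K] (v : FinitePlace K) :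
    ∃ (k : Type) (_ : Field k) (_ : Finite k) (R : Subring K) (f : R →+* k),
      (∀ x, x ∈ R ↔ v x ≤ 1) ∧ ∀ x : R, f x = 0 ↔ v (x : K) < 1 := by
  set w := v.maximalIdeal
  have hv : ∀ x : K, v x = WithZeroMulInt.toNNReal (HeightOneSpectrum.absNorm_ne_zero w)
      (w.valuation K x) := by
    intro x
    rw [← FinitePlace.norm_embedding', FinitePlace.norm_embedding_eq]
  have h1 := HeightOneSpectrum.one_lt_absNorm_nnreal w
  have hle : ∀ x : K, w.valuation K x ≤ 1 ↔ v x ≤ 1 := by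
    intro x
    rw [hv]
    have := WithZeroMulInt.toNNReal_le_one_iff (m := w.valuation K x) h1
    rw [← this]
    norm_cast
  have hlt : ∀ x : K, w.valuation K x < 1 ↔ v x < 1 := by
    intro x
    rw [hv]
    have := WithZeroMulInt.toNNReal_lt_one_iff (m := w.valuation K x) h1
    rw [← this]
    norm_cast
  let R := (w.valuation K).valuationSubring
  have hRlt : ∀ x : R, IsLocalRing.residue R x = 0 ↔ w.valuation K (x : K) < 1 := by
    intro x
    rw [IsLocalRing.residue_eq_zero_iff]
    exact Valuation.mem_maximalIdeal_iff K (w.valuation K)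
  refine ⟨IsLocalRing.ResidueField R, inferInstance, ?_, R.toSubring, IsLocalRing.residue R, ?_, ?_⟩
  · have hmem : ∀ a : 𝓞 K, algebraMap (𝓞 K) K a ∈ R := fun a => w.valuation_le_one a
    let g : 𝓞 K →+* R := (algebraMap (𝓞 K) K).codRestrict R.toSubring hmem
    let gg : 𝓞 K →+* IsLocalRing.ResidueField R := (IsLocalRing.residue R).comp g
    have : Finite (𝓞 K ⧸ w.asIdeal) := Ring.HasFiniteQuotients.finiteQuotient w.ne_bot
    have hker : ∀ a ∈ w.asIdeal, gg a = 0 := by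
      intro a ha
      change IsLocalRing.residue R (g a) = 0
      rw [hRlt]
      exact (w.valuation_lt_one_iff_mem a).mpr ha
    refine Finite.of_surjective (Ideal.Quotient.lift w.asIdeal gg hker) ?_
    apply Ideal.Quotient.lift_surjective_of_surjective
    intro y
    obtain ⟨x, rfl⟩ := IsLocalRing.residue_surjective y
    obtain ⟨a, ha⟩ := w.exists_valuation_sub_lt_of_integer (K := K) (x := x) x.2 1
    refine ⟨a, ?_⟩
    rw [← sub_eq_zero]
    change IsLocalRing.residue R (g a) - _ = 0
    rw [← map_sub, hRlt]
    exact ha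
  · intro x; exact hle x
  · intro x; exact (hRlt x).trans (hlt x)

/-- Reduction modulo a good place. -/
lemma su_reduce {K : Type} [Field K] [NumberField K] (v : FinitePlace K) {Γ : Type*} [Group Γ]
    (g : Γ →* SL(2, K)) (hg : ∀ γ i j, v ((g γ : Matrix (Fin 2) (Fin 2) K) i j) ≤ 1) (m : ℕ)
    (hm : 1 < m) (hvm : v (m : K) = 1) (ξ : K) (hξ : IsPrimitiveRoot (ξ ^ 2) m) (γ : Γ)
    (hγ : v ((g γ : Matrix (Fin 2) (Fin 2) K).trace - (ξ + ξ⁻¹)) < 1) : FinitisticOrder m γ := by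
  obtain ⟨k, _, _, R, f, hR, hf⟩ := su_residue v
  have hξpow : ξ ^ (2 * m) = 1 := by rw [pow_mul]; exact hξ.pow_eq_one
  have hξ0 : ξ ≠ 0 := by
    rintro rfl
    rw [zero_pow (by omega)] at hξpow
    exact zero_ne_one hξpow
  have hvξ : v ξ = 1 := by
    have : v ξ ^ (2 * m) = 1 := by rw [← map_pow, hξpow, map_one]
    exact (pow_eq_one_iff_of_nonneg (apply_nonneg v ξ) (by omega)).mp this
  have hvξ' : v ξ⁻¹ = 1 := by rw [map_inv₀, hvξ, inv_one]
  let x : R := ⟨ξ, (hR ξ).mpr hvξ.le⟩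
  let y : R := ⟨ξ⁻¹, (hR _).mpr hvξ'.le⟩
  have hxy : x * y = 1 := Subtype.ext (mul_inv_cancel₀ hξ0)
  have hfx0 : f x ≠ 0 := by
    intro h
    have := congrArg f hxy
    rw [map_mul, h, zero_mul, map_one] at this
    exact zero_ne_one this
  have hfy : f y = (f x)⁻¹ := by
    rw [← mul_right_inj' hfx0, mul_inv_cancel₀ hfx0, ← map_mul, hxy, map_one]
  have hmk : (m : k) ≠ 0 := by
    intro h
    have : f (m : R) = 0 := by simpa using h
    rw [hf] at this
    have h2 : ((m : R) : K) = (m : K) := by simp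
    rw [h2, hvm] at this
    exact lt_irrefl _ this
  have hprimR : IsPrimitiveRoot (x ^ 2) m := by
    refine IsPrimitiveRoot.of_map_of_injective (f := R.subtype) ?_ R.subtype_injective
    simpa [x] using hξ
  have hprim : IsPrimitiveRoot (f x ^ 2) m := by
    have : NeZero (m : k) := ⟨hmk⟩
    rw [← isRoot_cyclotomic_iff]
    have h1 := hprimR.isRoot_cyclotomic (by omega)
    have h2 := h1.map (f := f)
    rwa [map_cyclotomic, map_pow] at h2
  let F : SL(2, R) →* SL(2, K) := Matrix.SpecialLinearGroup.map R.subtype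
  have hFinj : Function.Injective F := by
    intro A B hAB
    ext i j
    have := congrArg (fun M : SL(2, K) => (M : Matrix (Fin 2) (Fin 2) K) i j) hAB
    simpa [F] using this
  have hrange : ∀ γ, g γ ∈ F.range := by
    intro γ
    let M : Matrix (Fin 2) (Fin 2) R := fun i j => ⟨_, (hR _).mpr (hg γ i j)⟩
    have hM : M.det = 1 := by
      apply Subtype.ext
      have := (g γ).2
      rw [Matrix.det_fin_two] at this ⊢
      simpa [M] using this
    refine ⟨⟨M, hM⟩, ?_⟩
    ext i j
    rfl
  let g' : Γ →* SL(2, R) := (MonoidHom.ofInjective hFinj).symm.toMonoidHom.comp (g.codRestrict F.range hrange)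
  have hg' : ∀ γ, F (g' γ) = g γ := by
    intro γ
    have := (MonoidHom.ofInjective hFinj).apply_symm_apply (g.codRestrict F.range hrange γ)
    exact congrArg Subtype.val this
  let q : Γ →* SL(2, k) := (Matrix.SpecialLinearGroup.map f).comp g'
  have hent : ∀ i j, (((g' γ : Matrix (Fin 2) (Fin 2) R) i j : R) : K) =
      (g γ : Matrix (Fin 2) (Fin 2) K) i j := by
    intro i j
    rw [← hg' γ]
    simp [F]
  have htr : (q γ : Matrix (Fin 2) (Fin 2) k).trace = f x + (f x)⁻¹ := by
    have h1 : f ((g' γ : Matrix (Fin 2) (Fin 2) R).trace - (x + y)) = 0 := by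
      rw [hf]
      convert hγ using 2
      rw [Matrix.trace_fin_two, Matrix.trace_fin_two, ← hent, ← hent]
      simp [x, y]
    rw [map_sub, map_add, hfy, sub_eq_zero] at h1
    rw [← h1, Matrix.trace_fin_two, Matrix.trace_fin_two, map_add]
    simp [q]
  have hne : f x ^ 2 ≠ 1 := hprim.ne_one hm
  have hord := su_order (q γ) (f x) hfx0 hne htr
  refine ⟨SL(2, k) ⧸ Subgroup.center SL(2, k), inferInstance, inferInstance,
    (QuotientGroup.mk' (Subgroup.center SL(2, k))).comp q, ?_⟩
  rw [MonoidHom.comp_apply, hord]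
  exact hprim.eq_orderOf.symm

lemma su_entries {K : Type} [Field K] [NumberField K] (v : FinitePlace K) (T : Set SL(2, K))
    (hT : ∀ A ∈ T, ∀ i j, v ((A : Matrix (Fin 2) (Fin 2) K) i j) ≤ 1) :
    ∀ A ∈ Subgroup.closure T, ∀ i j, v ((A : Matrix (Fin 2) (Fin 2) K) i j) ≤ 1 := by
  have hmax : ∀ a b : K, v a ≤ 1 → v b ≤ 1 → v (a + b) ≤ 1 := fun a b ha hb =>
    (FinitePlace.add_le v a b).trans (max_le ha hb)
  intro A hA
  induction hA using Subgroup.closure_induction with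
  | mem A hA => exact hT A hA
  | one =>
    intro i j
    fin_cases i <;> fin_cases j <;> simp
  | mul A B _ _ hA hB =>
    intro i j
    rw [Matrix.SpecialLinearGroup.coe_mul, Matrix.mul_apply, Fin.sum_univ_two]
    apply hmax <;> rw [map_mul] <;>
      exact mul_le_one₀ (hA _ _) (apply_nonneg v _) (hB _ _)
  | inv A _ hA =>
    intro i j
    rw [Matrix.SpecialLinearGroup.coe_inv, Matrix.adjugate_fin_two]
    have hneg : ∀ a : K, v (-a) = v a := fun a => map_neg_eq_map v a
    fin_cases i <;> fin_cases j <;> simp [hneg, hA]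

lemma su_alg {K : Type*} [Field K] (t a : K) (h : 2 * a ≠ 0) :
    1 - (t + a) / (2 * a) = -((t - a) / (2 * a)) := by
  rw [← div_self h, ← sub_div, ← neg_div]
  congr 1
  ring

lemma su_main (E : Type) [Field E] [NumberField E]
    (Γ : Subgroup SL(2, E)) (hfg : Γ.FG) (m : ℕ) (hm : 2 < m) :
    {t : E | ∃ γ : Γ, ¬ FinitisticOrder m γ ∧
      t = Matrix.trace ((γ : SL(2, E)) : Matrix (Fin 2) (Fin 2) E)}.Finite := by
  classical
  have : NeZero (2 * m) := ⟨by omega⟩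
  let K := CyclotomicField (2 * m) E
  have : NumberField K := IsCyclotomicExtension.numberField {2 * m} E K
  obtain ⟨ζ, hζ⟩ : ∃ ζ : K, IsPrimitiveRoot ζ (2 * m) := ⟨_, IsCyclotomicExtension.zeta_spec (2*m) E K⟩
  have hζ0 : ζ ≠ 0 := hζ.ne_zero (by omega)
  have hζ2 : IsPrimitiveRoot (ζ ^ 2) m := hζ.pow (by omega) rfl
  have hζ2' : IsPrimitiveRoot ((-ζ) ^ 2) m := by rwa [neg_sq]
  set a : K := ζ + ζ⁻¹ with ha
  have ha0 : a ≠ 0 := by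
    intro h
    have h1 : ζ ^ 2 = -1 := by
      have := mul_inv_cancel₀ hζ0
      linear_combination ζ * h - this
    have h2 : ζ ^ 4 = 1 := by
      calc ζ ^ 4 = (ζ^2)^2 := by ring
        _ = 1 := by rw [h1]; ring
    have := Nat.le_of_dvd (by norm_num) (hζ.dvd_of_pow_eq_one 4 h2)
    omega
  let F : SL(2, E) →* SL(2, K) := Matrix.SpecialLinearGroup.map (algebraMap E K)
  obtain ⟨T, hT⟩ := hfg
  let Z : Finset K := insert (m : K) (insert (2 * a) (T.biUnion fun A =>
    (Finset.univ : Finset (Fin 2 × Fin 2)).image fun ij =>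
      (F A : Matrix (Fin 2) (Fin 2) K) ij.1 ij.2))
  have hfin : {v : FinitePlace K | ∃ x ∈ Z, x ≠ 0 ∧ v x ≠ 1}.Finite := by
    have : {v : FinitePlace K | ∃ x ∈ Z, x ≠ 0 ∧ v x ≠ 1} ⊆
        ⋃ x ∈ Z.filter (· ≠ 0), {v : FinitePlace K | v x ≠ 1} := by
      rintro v ⟨x, hx, hx0, hv⟩
      simp only [Set.mem_iUnion]
      exact ⟨x, by simp [hx, hx0], hv⟩
    refine Set.Finite.subset (Set.Finite.biUnion (Finset.finite_toSet _) ?_) this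
    intro x hx
    exact FinitePlace.hasFiniteMulSupport (by simpa using (Finset.mem_filter.mp hx).2)
  let S : Finset (FinitePlace K) := hfin.toFinset
  have hS : ∀ v ∉ S, ∀ x ∈ Z, x ≠ 0 → v x = 1 := by
    intro v hv x hx hx0
    by_contra h
    exact hv (hfin.mem_toFinset.mpr ⟨x, hx, hx0, h⟩)
  have hv2a : ∀ v ∉ S, v (2 * a) = 1 := fun v hv => hS v hv _ (by simp [Z]) (by simp [ha0])
  have hvm : ∀ v ∉ S, v (m : K) = 1 := fun v hv => hS v hv _ (by simp [Z])
    (by exact_mod_cast (by omega : m ≠ 0))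
  have hent : ∀ v ∉ S, ∀ A ∈ Γ, ∀ i j, v ((F A : Matrix (Fin 2) (Fin 2) K) i j) ≤ 1 := by
    intro v hv A hA
    refine su_entries v (Set.image F (T : Set SL(2, E))) ?_ (F A) ?_
    · rintro _ ⟨B, hB, rfl⟩ i j
      by_cases h0 : (F B : Matrix (Fin 2) (Fin 2) K) i j = 0
      · rw [h0, map_zero]; exact zero_le_one
      · refine (hS v hv _ ?_ h0).le
        simp only [Z, Finset.mem_insert, Finset.mem_biUnion, Finset.mem_image]
        exact Or.inr (Or.inr ⟨B, hB, (i, j), Finset.mem_univ _, rfl⟩)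
    · rw [← MonoidHom.map_closure, hT]
      exact ⟨A, hA, rfl⟩
  have hva : ∀ v : FinitePlace K, v a ≤ 1 := by
    intro v
    have h1 : v ζ = 1 := by
      have : v ζ ^ (2 * m) = 1 := by rw [← map_pow, hζ.pow_eq_one, map_one]
      exact (pow_eq_one_iff_of_nonneg (apply_nonneg v ζ) (by omega)).mp this
    refine (FinitePlace.add_le v _ _).trans (max_le h1.le ?_)
    rw [map_inv₀, h1, inv_one]
  let φ : E → K := fun t => (algebraMap E K t + a) / (2 * a)
  have h2a : (2 * a : K) ≠ 0 := by simp [ha0]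
  have hφ : Function.Injective φ := by
    intro s t hst
    apply (algebraMap E K).injective
    have := (div_left_inj' h2a).mp hst
    exact add_right_cancel this
  refine (((su_sunit S).union (Set.toFinite ({0, 1} : Set K))).preimage hφ.injOn).subset ?_
  rintro t ⟨γ, hγ, rfl⟩
  set t := Matrix.trace ((γ : SL(2, E)) : Matrix (Fin 2) (Fin 2) E) with ht
  have htr : algebraMap E K t = (F γ : Matrix (Fin 2) (Fin 2) K).trace := by
    rw [ht, Matrix.trace_fin_two, Matrix.trace_fin_two]
    simp [F]
  have hφ1 : 1 - φ t = -((algebraMap E K t - a) / (2 * a)) := by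
    exact su_alg _ _ h2a
  by_cases hc1 : algebraMap E K t + a = 0
  · right; left; simp only [φ]; rw [hc1, zero_div]
  by_cases hc2 : algebraMap E K t - a = 0
  · right; right
    rw [hc2, zero_div, neg_zero, sub_eq_zero] at hφ1
    exact hφ1.symm
  left
  have hvt : ∀ v ∉ S, v (algebraMap E K t) ≤ 1 := by
    intro v hv
    rw [htr, Matrix.trace_fin_two]
    exact (FinitePlace.add_le v _ _).trans (max_le (hent v hv _ γ.2 _ _) (hent v hv _ γ.2 _ _))
  have key : ∀ v ∉ S, ∀ ξ : K, IsPrimitiveRoot (ξ ^ 2) m →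
      ¬ v (algebraMap E K t - (ξ + ξ⁻¹)) < 1 := by
    intro v hv ξ hξ hlt
    rw [htr] at hlt
    exact hγ (su_reduce v (F.comp Γ.subtype) (fun δ => hent v hv _ δ.2) m (by omega) (hvm v hv) ξ hξ
      γ hlt)
  have hplus : ∀ v ∉ S, v (algebraMap E K t + a) = 1 := by
    intro v hv
    refine le_antisymm ((FinitePlace.add_le v _ _).trans (max_le (hvt v hv) (hva v))) ?_
    have := key v hv (-ζ) hζ2'
    rw [inv_neg, ← neg_add, sub_neg_eq_add] at this
    exact not_lt.mp this
  have hminus : ∀ v ∉ S, v (algebraMap E K t - a) = 1 := by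
    intro v hv
    refine le_antisymm ?_ (not_lt.mp (key v hv ζ hζ2))
    rw [sub_eq_add_neg]
    refine (FinitePlace.add_le v _ _).trans (max_le (hvt v hv) ?_)
    rw [map_neg_eq_map v a]
    exact hva v
  refine ⟨⟨div_ne_zero hc1 h2a, fun v hv => ?_⟩, ?_⟩
  · simp only [φ]
    rw [map_div₀, hplus v hv, hv2a v hv, div_one]
  · rw [hφ1]
    refine ⟨neg_ne_zero.mpr (div_ne_zero hc2 h2a), fun v hv => ?_⟩
    rw [map_neg_eq_map v, map_div₀, hminus v hv, hv2a v hv, div_one]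

end GroupPart


/-- For a finitely generated subgroup `Γ ≤ SL₂(E)` over a number field `E` and an integer
`m > 2`, the traces of those elements of `Γ` for which `m` is not a finitistic order form
a finite subset of `E`. -/
theorem traces_of_exceptional_elements_finite (E : Type) [Field E] [NumberField E]
    (Γ : Subgroup SL(2, E)) (hfg : Γ.FG) (m : ℕ) (hm : 2 < m) :
    {t : E | ∃ γ : Γ, ¬ FinitisticOrder m γ ∧
      t = Matrix.trace ((γ : SL(2, E)) : Matrix (Fin 2) (Fin 2) E)}.Finite := by
  exact su_main E Γ hfg m hm
end
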